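/- arXiv:0710.0813 — 4 statements merged into one kernel-verified Lean document; each statement's English description precedes it below -/
import Mathlib

section
/- Let R be a valuation domain with maximal ideal P, and let A be a non-zero archimedean ideal of R (i.e., A^♯ = P) such that A ≠ Pa for all a ∈ R. If R/A is not complete in the R/A-topology, then there exists an indecomposable reflexive R-module of rank 2. -/
open Pointwise

section Defs
universe u v
variable (R : Type u) [CommRing R]

/-- `U` is a pure submodule of its ambient module: `rU = U ∩ rM` for all `r`. -/
def IsPureSub {M : Type v} [AddCommGroup M] [Module R M] (U : Submodule R M) : Prop :=
  ∀ (r : R) (x : M), x ∈ U → (∃ m : M, r • m = x) → ∃ u ∈ U, r • u = x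

/-- `U` is uniserial: its submodules are totally ordered by inclusion. -/
def IsUniserialSub {M : Type v} [AddCommGroup M] [Module R M] (U : Submodule R M) : Prop :=
  ∀ A B : Submodule R ↥U, A ≤ B ∨ B ≤ A

/-- `U` is a direct summand of its ambient module. -/
def IsSummand {M : Type v} [AddCommGroup M] [Module R M] (U : Submodule R M) : Prop :=
  ∃ V : Submodule R M, IsCompl U V

/-- A (torsion-free) module is separable if every pure uniserial submodule is a summand. -/
def IsSeparableMod (M : Type v) [AddCommGroup M] [Module R M] : Prop :=
  ∀ U : Submodule R M, IsPureSub R U → IsUniserialSub R U → IsSummand R U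

/-- `R/A` is complete in the `R/A`-topology: every coherent family of cosets
`(aᵢ + Bᵢ)` with `⋂ᵢ Bᵢ = A` has a common point. -/
def IsCompleteQuot (A : Ideal R) : Prop :=
  ∀ (ι : Type u) (a : ι → R) (B : ι → Ideal R),
    (∀ i, A ≤ B i) → (∀ i j, B i ≤ B j → a i - a j ∈ B j) → (⨅ i, B i) = A →
    ∃ c : R, ∀ i, c - a i ∈ B i

/-- A valuation ring with maximal ideal `P` is maximal: `R/A` is complete in the
`R/A`-topology for every proper ideal `A` with `A ≠ Pa` for all nonzero `a`. -/
def IsMaximalVD (P : Ideal R) : Prop :=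
  ∀ A : Ideal R, A ≠ ⊤ → (∀ a : R, a ≠ 0 → A ≠ Ideal.span {a} * P) → IsCompleteQuot R A

/-- A module `M` is slender if every homomorphism `R^ℕ → M` kills almost all
standard unit vectors. -/
def IsSlender (M : Type v) [AddCommGroup M] [Module R M] : Prop :=
  ∀ f : ((ℕ → R) →ₗ[R] M), ∃ n₀ : ℕ, ∀ n ≥ n₀, f (Pi.single n 1) = 0

end Defs

section CosetModule

variable {R : Type*} [CommRing R]

/-- The submodule of `R × R` of pairs `(p, q)` such that `q` is a common point of the cosets
`p * a i + B i`. -/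
def cosetModule {ι : Type*} (a : ι → R) (B : ι → Ideal R) : Submodule R (R × R) where
  carrier := {x | ∀ i, x.2 - x.1 * a i ∈ B i}
  zero_mem' := by simp
  add_mem' := by
    intro x y hx hy i
    have h := (B i).add_mem (hx i) (hy i)
    have e : (x + y).2 - (x + y).1 * a i = x.2 - x.1 * a i + (y.2 - y.1 * a i) := by
      simp only [Prod.fst_add, Prod.snd_add]; ring
    rwa [e]
  smul_mem' := by
    intro r x hx i
    have h := (B i).mul_mem_left r (hx i)
    have e : (r • x).2 - (r • x).1 * a i = r * (x.2 - x.1 * a i) := by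
      simp only [Prod.smul_fst, Prod.smul_snd, smul_eq_mul]; ring
    rwa [e]

theorem mem_cosetModule {ι : Type*} {a : ι → R} {B : ι → Ideal R} {x : R × R} :
    x ∈ cosetModule a B ↔ ∀ i, x.2 - x.1 * a i ∈ B i := Iff.rfl

theorem mk_mem_cosetModule {ι : Type*} {a : ι → R} {B : ι → Ideal R} {x y : R}
    (hx : ∀ i, x ∈ B i) (hy : ∀ i, y ∈ B i) : (x, y) ∈ cosetModule a B :=
  fun i => (B i).sub_mem (hy i) ((B i).mul_mem_right _ (hx i))

theorem exists_of_not_isCompleteQuot {R : Type u} [CommRing R] {A : Ideal R} (h : ¬ IsCompleteQuot R A) :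
    ∃ (ι : Type u) (a : ι → R) (B : ι → Ideal R), (∀ i, A < B i) ∧
      (∀ i j, B i ≤ B j → a i - a j ∈ B j) ∧ (⨅ i, B i) = A ∧
      ¬ ∃ c : R, ∀ i, c - a i ∈ B i := by
  unfold IsCompleteQuot at h
  push Not at h
  obtain ⟨ι, a, B, hAB, hcoh, hinf, hc⟩ := h
  refine ⟨ι, a, B, fun i => lt_of_le_of_ne (hAB i) ?_, hcoh, hinf, by push Not; exact hc⟩
  intro hi
  obtain ⟨j, hj⟩ := hc (a i)
  exact hj (hcoh i j (hi ▸ hAB j))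

section Domain

variable [IsDomain R]

theorem rank_submodule_prod_self_eq_two (N : Submodule R (R × R)) {b : R} (hb : b ≠ 0)
    (hN : ∀ x : R × R, b • x ∈ N) : Module.rank R N = 2 := by
  have h2 : Module.rank R (R × R) = 2 := by
    rw [rank_prod', Module.rank_self]; norm_num
  apply le_antisymm
  · exact h2 ▸ N.rank_le
  · have hinj : Function.Injective ((LinearMap.lsmul R (R × R) b).codRestrict N hN) := by
      intro x y hxy
      have h : b • x = b • y := congrArg Subtype.val hxy
      exact smul_right_injective _ hb h
    exact h2 ▸ LinearMap.rank_le_of_injective _ hinj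

/-- A linear form with values in `b R` can be divided by `b`. -/
theorem exists_mul_eq_of_forall_dvd {M : Type*} [AddCommGroup M] [Module R M] (f : M →ₗ[R] R)
    {b : R} (hb : b ≠ 0) (h : ∀ m, b ∣ f m) : ∃ g : M →ₗ[R] R, b • g = f := by
  choose g hg using h
  refine ⟨⟨⟨g, fun x y => mul_left_cancel₀ hb ?_⟩, fun r x => mul_left_cancel₀ hb ?_⟩, ?_⟩
  · rw [mul_add, ← hg, ← hg, ← hg, map_add]
  · change b * g (r • x) = b * (r * g x)
    rw [mul_left_comm, ← hg, ← hg, map_smul, smul_eq_mul]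
  · ext x
    exact (hg x).symm

/-- A submodule of `R × R` which contains `b (R × R)` is reflexive as soon as every pair of
values on the coordinate forms of an element of the bidual lies in it. -/
theorem isReflexive_submodule_prod (N : Submodule R (R × R)) {b : R} (hb : b ≠ 0)
    (hN : ∀ x : R × R, b • x ∈ N)
    (hdual : ∀ F : Module.Dual R (Module.Dual R N),
      (F (LinearMap.fst R R R ∘ₗ N.subtype), F (LinearMap.snd R R R ∘ₗ N.subtype)) ∈ N) :
    Module.IsReflexive R N := by
  refine ⟨⟨fun x y hxy => ?_, fun F => ⟨⟨_, hdual F⟩, ?_⟩⟩⟩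
  · have h1 := LinearMap.congr_fun hxy (LinearMap.fst R R R ∘ₗ N.subtype)
    have h2 := LinearMap.congr_fun hxy (LinearMap.snd R R R ∘ₗ N.subtype)
    exact Subtype.ext (Prod.ext h1 h2)
  · ext f
    have key : b • f = f ⟨_, hN (1, 0)⟩ • (LinearMap.fst R R R ∘ₗ N.subtype) +
        f ⟨_, hN (0, 1)⟩ • (LinearMap.snd R R R ∘ₗ N.subtype) := by
      ext x
      have hx : b • x = x.1.1 • (⟨_, hN (1, 0)⟩ : N) + x.1.2 • (⟨_, hN (0, 1)⟩ : N) := by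
        apply Subtype.ext
        ext <;> simp [mul_comm]
      have := congrArg f hx
      simp only [map_smul, map_add, smul_eq_mul] at this
      simp only [LinearMap.smul_apply, LinearMap.add_apply, LinearMap.comp_apply,
        Submodule.subtype_apply, LinearMap.fst_apply, LinearMap.snd_apply, smul_eq_mul]
      rw [this]; ring
    apply mul_left_cancel₀ hb
    have hF := congrArg F key
    have hf := LinearMap.congr_fun key ⟨_, hdual F⟩
    simp only [map_smul, map_add, smul_eq_mul] at hF
    rw [hF]
    exact hf

end Domain

section Valuation

variable [IsDomain R] [ValuationRing R]

theorem le_span_singleton_of_notMem {I : Ideal R} {x : R} (hx : x ∉ I) :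
    I ≤ Ideal.span {x} := by
  intro y hy
  rw [Ideal.mem_span_singleton]
  rcases ValuationRing.dvd_total x y with h | h
  · exact h
  · exact absurd (I.mem_of_dvd h hy) hx

theorem ideal_le_total (I J : Ideal R) : I ≤ J ∨ J ≤ I :=
  (ValuationRing.le_total_ideal R).total I J

theorem isReflexive_cosetModule {A : Ideal R} (hA0 : A ≠ ⊥) {ι : Type*} {a : ι → R}
    {B : ι → Ideal R} (hAB : ∀ i, A < B i) (hcoh : ∀ i j, B i ≤ B j → a i - a j ∈ B j)
    (hinf : (⨅ i, B i) = A) : Module.IsReflexive R (cosetModule a B) := by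
  obtain ⟨b, hbA, hb⟩ := Submodule.exists_mem_ne_zero_of_ne_bot hA0
  refine isReflexive_submodule_prod _ hb (fun x => mk_mem_cosetModule
    (fun i => (B i).mul_mem_right _ ((hAB i).le hbA))
    (fun i => (B i).mul_mem_right _ ((hAB i).le hbA))) fun F => ?_
  rw [mem_cosetModule]
  intro i
  obtain ⟨d, hdB, hdA⟩ := SetLike.exists_of_lt (hAB i)
  obtain ⟨k, hk⟩ : ∃ k, d ∉ B k := by
    by_contra! h
    exact hdA (hinf ▸ (Submodule.mem_iInf _).2 h)
  have hBk := le_span_singleton_of_notMem hk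
  have hd0 : d ≠ 0 := fun h => hdA (h ▸ A.zero_mem)
  have hspan : Ideal.span {d} ≤ B i := (Ideal.span_singleton_le_iff_mem _).2 hdB
  obtain ⟨g, hg⟩ := exists_mul_eq_of_forall_dvd
    (LinearMap.snd R R R ∘ₗ (cosetModule a B).subtype -
      a k • (LinearMap.fst R R R ∘ₗ (cosetModule a B).subtype)) hd0 (fun m => by
        have h := Ideal.mem_span_singleton.1 (hBk (m.2 k))
        rw [mul_comm] at h
        exact h)
  have hF := congrArg F hg
  simp only [map_smul, map_sub, smul_eq_mul] at hF
  have h1 : F (LinearMap.snd R R R ∘ₗ (cosetModule a B).subtype) -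
      a k * F (LinearMap.fst R R R ∘ₗ (cosetModule a B).subtype) ∈ B i :=
    hF ▸ (B i).mul_mem_right _ hdB
  have h2 := (B i).mul_mem_left (F (LinearMap.fst R R R ∘ₗ (cosetModule a B).subtype))
    (hcoh k i (hBk.trans hspan))
  convert (B i).add_mem h1 h2 using 1
  ring

/-- An archimedean proper ideal is strictly smaller than `{x | p x ∈ A}` for `p ∈ P`. -/
theorem exists_mul_mem_of_smul_ne {A : Ideal R} (hA : A ≠ ⊤) {p : R} (hp : p • A ≠ A) :
    ∃ x, p * x ∈ A ∧ x ∉ A := by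
  by_contra! h
  apply hp
  apply le_antisymm
  · intro y hy
    obtain ⟨z, hz, rfl⟩ := Submodule.mem_smul_pointwise_iff_exists _ _ _ |>.1 hy
    exact A.mul_mem_left _ hz
  · intro x hx
    have hpx : p ∣ x := by
      rcases ValuationRing.dvd_total p x with h' | h'
      · exact h'
      · exact absurd ((Ideal.eq_top_iff_one A).2
          (h 1 (by rw [mul_one]; exact A.mem_of_dvd h' hx))) hA
    obtain ⟨y, rfl⟩ := hpx
    exact Submodule.smul_mem_pointwise_smul _ _ _ (h y hx)

theorem exists_fst_eq {A : Ideal R} (hA : A ≠ ⊤) {ι : Type*} {a : ι → R}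
    {B : ι → Ideal R} (hAB : ∀ i, A < B i) (hcoh : ∀ i j, B i ≤ B j → a i - a j ∈ B j)
    (hinf : (⨅ i, B i) = A) {p : R} (hp : p • A ≠ A) :
    ∃ q, (p, q) ∈ cosetModule a B := by
  obtain ⟨x, hpx, hx⟩ := exists_mul_mem_of_smul_ne hA hp
  obtain ⟨j, hj⟩ : ∃ j, x ∉ B j := by
    by_contra! h
    exact hx (hinf ▸ (Submodule.mem_iInf _).2 h)
  refine ⟨p * a j, fun i => ?_⟩
  change p * a j - p * a i ∈ B i
  rw [← mul_sub]
  rcases ideal_le_total (B j) (B i) with h | h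
  · exact (B i).mul_mem_left _ (hcoh j i h)
  · obtain ⟨z, hz⟩ := Ideal.mem_span_singleton.1
      (le_span_singleton_of_notMem hj (hcoh i j h))
    have e : p * (a j - a i) = -(p * x * z) := by
      rw [mul_assoc, ← hz]; ring
    rw [e]
    exact (hAB i).le (A.neg_mem (A.mul_mem_right _ hpx))

/-- If the maximal ideal `P` is principal, every archimedean proper ideal has the form `a P`. -/
theorem exists_eq_span_mul_of_principal {P A : Ideal R} (hP : P.IsMaximal) (hA : A ≠ ⊤)
    {t : R} (ht : P = Ideal.span {t}) (htA : t • A ≠ A) :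
    ∃ y, A = Ideal.span {y} * P := by
  have hle : t • A ≤ A := by
    intro y hy
    obtain ⟨z, hz, rfl⟩ := Submodule.mem_smul_pointwise_iff_exists _ _ _ |>.1 hy
    exact A.mul_mem_left _ hz
  obtain ⟨x, hxA, hx⟩ := SetLike.exists_of_lt (lt_of_le_of_ne hle htA)
  have hxspan : A = Ideal.span {x} := by
    refine le_antisymm (fun y hy => Ideal.mem_span_singleton.2 ?_)
      ((Ideal.span_singleton_le_iff_mem _).2 hxA)
    rcases ValuationRing.dvd_total x y with h | ⟨z, rfl⟩
    · exact h
    · by_cases hz : IsUnit z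
      · exact (hz.mul_right_dvd).2 dvd_rfl
      · have hzP : z ∈ P := by
          rw [IsLocalRing.eq_maximalIdeal hP]
          exact hz
        rw [ht, Ideal.mem_span_singleton] at hzP
        obtain ⟨w, rfl⟩ := hzP
        refine absurd ?_ hx
        have e : y * (t * w) = t • (y * w) := by rw [smul_eq_mul]; ring
        rw [e]
        exact Submodule.smul_mem_pointwise_smul _ _ _ (A.mul_mem_right _ hy)
  have hAP : A ≤ P := by
    rw [IsLocalRing.eq_maximalIdeal hP]
    exact IsLocalRing.le_maximalIdeal hA
  obtain ⟨y, hy⟩ := Ideal.mem_span_singleton.1 (ht ▸ hAP hxA)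
  refine ⟨y, ?_⟩
  rw [ht, Ideal.span_singleton_mul_span_singleton, hxspan, hy, mul_comm]

/-- If `P (c - a i) ⊆ B i` for all `i`, then `c` is a common point of the cosets `a i + B i`. -/
theorem sub_mem_of_forall_mul_mem {P A : Ideal R} (hP : P.IsMaximal) {ι : Type*} {a : ι → R}
    {B : ι → Ideal R} (hAB : ∀ i, A < B i) (hcoh : ∀ i j, B i ≤ B j → a i - a j ∈ B j)
    (hinf : (⨅ i, B i) = A) {c : R} (hc : ∀ p ∈ P, ∀ i, p * (c - a i) ∈ B i) (i : ι) :
    c - a i ∈ B i := by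
  by_contra hci
  obtain ⟨d, hdB, hdA⟩ := SetLike.exists_of_lt (hAB i)
  obtain ⟨k, hk⟩ : ∃ k, d ∉ B k := by
    by_contra! h
    exact hdA (hinf ▸ (Submodule.mem_iInf _).2 h)
  have hki : B k ≤ B i := (ideal_le_total (B k) (B i)).resolve_right fun h => hk (h hdB)
  have hck : c - a k ∉ B i := fun h => hci (by
    have := (B i).add_mem h (hcoh k i hki)
    rwa [sub_add_sub_cancel] at this)
  obtain ⟨z, hz⟩ := Ideal.mem_span_singleton.1 (le_span_singleton_of_notMem hck hdB)
  by_cases hu : IsUnit z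
  · obtain ⟨u, rfl⟩ := hu
    exact hck (Ideal.mem_of_dvd (B i) (by rw [hz]; exact (u.isUnit.mul_right_dvd).2 dvd_rfl) hdB)
  · apply hk
    rw [hz, mul_comm]
    exact hc z (by rw [IsLocalRing.eq_maximalIdeal hP]; exact hu) k

/-- A submodule of the coset module is zero if it is disjoint from one with first projection `P`. -/
theorem eq_bot_of_disjoint_cosetModule {P A : Ideal R} (hP : P.IsMaximal) (hP0 : P ≠ ⊥)
    (hPt : ∀ t, P ≠ Ideal.span {t}) {ι : Type*} {a : ι → R}
    {B : ι → Ideal R} (hAB : ∀ i, A < B i) (hcoh : ∀ i j, B i ≤ B j → a i - a j ∈ B j)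
    (hinf : (⨅ i, B i) = A) (hnc : ¬ ∃ c : R, ∀ i, c - a i ∈ B i)
    {U V : Submodule R (cosetModule a B)} (hUV : Disjoint U V)
    (hU : ∀ p, p ∈ P ↔ ∃ u ∈ U, u.1.1 = p) : V = ⊥ := by
  obtain ⟨p₀, hp₀P, hp₀⟩ := Submodule.exists_mem_ne_zero_of_ne_bot hP0
  obtain ⟨u₀, hu₀, rfl⟩ := (hU p₀).1 hp₀P
  by_cases hker : ∃ k ∈ U, k ≠ 0 ∧ k.1.1 = 0
  · obtain ⟨k, hkU, hk0, hk1⟩ := hker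
    have hk2 : k.1.2 ≠ 0 := fun h => hk0 (Subtype.ext (Prod.ext hk1 h))
    rw [Submodule.eq_bot_iff]
    intro v hv
    have e : (k.1.2 * u₀.1.1) • v = (k.1.2 * v.1.1) • u₀ +
        (u₀.1.1 * v.1.2 - v.1.1 * u₀.1.2) • k := by
      apply Subtype.ext
      ext
      · simp [hk1]; ring
      · simp; ring
    have hmem : (k.1.2 * u₀.1.1) • v ∈ U := by
      rw [e]; exact U.add_mem (U.smul_mem _ hu₀) (U.smul_mem _ hkU)
    have h0 := Submodule.disjoint_def.1 hUV _ hmem (V.smul_mem _ hv)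
    exact (smul_eq_zero.1 h0).resolve_left (mul_ne_zero hk2 hp₀)
  · push Not at hker
    have hprop : ∀ u ∈ U, u₀.1.1 * u.1.2 = u.1.1 * u₀.1.2 := by
      intro u hu
      have hw : u₀.1.1 • u - u.1.1 • u₀ ∈ U := U.sub_mem (U.smul_mem _ hu) (U.smul_mem _ hu₀)
      have h0 : u₀.1.1 • u - u.1.1 • u₀ = 0 := by
        by_contra h
        exact hker _ hw h (by simp [mul_comm])
      have h2 := congrArg (fun w : cosetModule a B => w.1.2) h0
      simpa [sub_eq_zero] using h2
    exfalso
    by_cases hdvd : u₀.1.1 ∣ u₀.1.2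
    · obtain ⟨c, hc⟩ := hdvd
      refine hnc ⟨c, sub_mem_of_forall_mul_mem hP hAB hcoh hinf fun p hp i => ?_⟩
      obtain ⟨u, hu, rfl⟩ := (hU p).1 hp
      have h := hprop u hu
      have hc' : u.1.2 = u.1.1 * c := mul_left_cancel₀ hp₀ (by rw [h, hc]; ring)
      have hm := u.2 i
      rwa [hc', ← mul_sub] at hm
    · obtain ⟨t, ht⟩ := (ValuationRing.dvd_total u₀.1.1 u₀.1.2).resolve_left hdvd
      have hq0 : u₀.1.2 ≠ 0 := fun h => hdvd (h ▸ dvd_zero _)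
      have htP : t ∈ P := by
        rw [IsLocalRing.eq_maximalIdeal hP]
        intro hu
        exact hdvd (by rw [ht]; exact (hu.mul_right_dvd).2 dvd_rfl)
      refine hPt t (le_antisymm (fun p hp => ?_) ((Ideal.span_singleton_le_iff_mem _).2 htP))
      obtain ⟨u, hu, rfl⟩ := (hU p).1 hp
      refine Ideal.mem_span_singleton.2 ⟨u.1.2, mul_left_cancel₀ hq0 ?_⟩
      rw [mul_comm u₀.1.2, ← hprop u hu, ← mul_assoc, ← ht]

end Valuation

end CosetModule

/-- if `A` is a nonzero archimedean ideal with `A ≠ Pa` for all `a`, and `R/A`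
is not complete in the `R/A`-topology, then there is an indecomposable reflexive module of
rank 2. -/
theorem stmt_5 {R : Type u} [CommRing R] [IsDomain R] [ValuationRing R]
    (P : Ideal R) (hP : P.IsMaximal) (A : Ideal R) (hA0 : A ≠ ⊥)
    (harch : ∀ s : R, s • A ≠ A ↔ s ∈ P)
    (hPa : ∀ a : R, A ≠ Ideal.span {a} * P)
    (hnc : ¬ IsCompleteQuot R A) :
    ∃ (M : Type u) (_ : AddCommGroup M) (_ : Module R M),
      Module.IsReflexive R M ∧ Module.rank R M = 2 ∧
      ∀ U V : Submodule R M, IsCompl U V → U = ⊥ ∨ V = ⊥ := by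
  obtain ⟨ι, a, B, hAB, hcoh, hinf, hlim⟩ := exists_of_not_isCompleteQuot hnc
  have hA : A ≠ ⊤ := by
    rintro rfl
    exact hlim ⟨0, fun i => absurd (hAB i) not_top_lt⟩
  have hP0 : P ≠ ⊥ := by
    rintro rfl
    have := IsLocalRing.le_maximalIdeal hA
    rw [← IsLocalRing.eq_maximalIdeal hP] at this
    exact hA0 (le_bot_iff.1 this)
  have hPt : ∀ t, P ≠ Ideal.span {t} := by
    intro t ht
    obtain ⟨y, hy⟩ := exists_eq_span_mul_of_principal hP hA ht
      ((harch t).2 (ht ▸ Ideal.mem_span_singleton_self t))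
    exact hPa y hy
  refine ⟨cosetModule a B, inferInstance, inferInstance,
    isReflexive_cosetModule hA0 hAB hcoh hinf, ?_, fun U V hUV => ?_⟩
  · obtain ⟨b, hbA, hb⟩ := Submodule.exists_mem_ne_zero_of_ne_bot hA0
    exact rank_submodule_prod_self_eq_two _ hb fun x => mk_mem_cosetModule
      (fun i => (B i).mul_mem_right _ ((hAB i).le hbA))
      (fun i => (B i).mul_mem_right _ ((hAB i).le hbA))
  · let π : cosetModule a B →ₗ[R] R := LinearMap.fst R R R ∘ₗ (cosetModule a B).subtype
    have hrange : U.map π ⊔ V.map π = P := by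
      rw [← Submodule.map_sup, hUV.sup_eq_top, Submodule.map_top]
      refine le_antisymm ?_ fun p hp => ?_
      · rintro _ ⟨x, rfl⟩
        by_contra hx
        have hunit : IsUnit x.1.1 := by
          rw [IsLocalRing.eq_maximalIdeal hP, IsLocalRing.mem_maximalIdeal, mem_nonunits_iff,
            not_not] at hx
          exact hx
        obtain ⟨w, hw⟩ := hunit.exists_left_inv
        refine hlim ⟨w * x.1.2, fun i => ?_⟩
        have h := (B i).mul_mem_left w (x.2 i)
        rwa [mul_sub, ← mul_assoc, hw, one_mul] at h
      · obtain ⟨q, hq⟩ := exists_fst_eq hA hAB hcoh hinf ((harch p).2 hp)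
        exact ⟨⟨_, hq⟩, rfl⟩
    rcases ideal_le_total (U.map π) (V.map π) with h | h
    · left
      rw [sup_eq_right.2 h] at hrange
      exact eq_bot_of_disjoint_cosetModule hP hP0 hPt hAB hcoh hinf hlim hUV.disjoint.symm
        fun p => hrange ▸ Iff.rfl
    · right
      rw [sup_eq_left.2 h] at hrange
      exact eq_bot_of_disjoint_cosetModule hP hP0 hPt hAB hcoh hinf hlim hUV.disjoint
        fun p => hrange ▸ Iff.rfl
end

section
/- Let R be a valuation domain with maximal ideal P such that R_L is countably generated as an R-module for each prime ideal L, and let J = ⋂_{n∈ℕ} P^n. Then R^R (the product of copies of R indexed by the underlying set of R) is separable if and only if R_J is a maximal valuation domain. -/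
open Pointwise

open Classical in
/-- If an element `a` controls the values of `h` on functions with bounded support, a coherent
system of residues is solved, up to the factor `a`, by the value of `h` at a single function. -/
theorem exists_map_eq_of_coherent {R : Type*} [CommRing R] [IsDomain R] [ValuationRing R]
    {κ : Type*} [LinearOrder κ] [WellFoundedLT κ]
    (h : (κ → R) →ₗ[R] R) (a : R) (ha : a ≠ 0) (h1 : h 1 = a)
    (hb : ∀ z β, (∀ α, β ≤ α → z α = 0) → ∃ p, ¬ IsUnit p ∧ h z = a * p)
    (c r : κ → R) (hc : ∀ α β, β ≤ α → r β ∣ c α - c β) :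
    ∃ y : κ → R, ∀ β, ∃ w, h y - a * c β = r β * h w := by
  let tr : κ → (κ → R) → κ → R := fun β z α => if α < β then z α else 0
  have htr : ∀ β z, ∃ p, ¬ IsUnit p ∧ h (tr β z) = a * p := fun β z =>
    hb _ β fun α hα => by simp [tr, not_lt.2 hα]
  have hun : ∀ β, ∃ p, IsUnit p ∧ h (1 - tr β 1) = a * p := by
    intro β
    obtain ⟨p, hp, hpe⟩ := htr β 1
    refine ⟨1 - p, ?_, by rw [map_sub, h1, hpe]; ring⟩
    by_contra hcon
    exact IsLocalRing.nonunits_add (a := p) (b := 1 - p) hp hcon (by simp)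
  have hex : ∀ β z, ∃ y : R, a * c β = h (tr β z) + y * h (1 - tr β 1) := by
    intro β z
    obtain ⟨p, -, hpe⟩ := htr β z
    obtain ⟨q, ⟨q, rfl⟩, hqe⟩ := hun β
    refine ⟨(c β - p) * ↑q⁻¹, ?_⟩
    rw [hpe, hqe]
    linear_combination (-a * (c β - p)) * (q.inv_mul)
  choose Y hY using hex
  let y : κ → R := (wellFounded_lt (α := κ)).fix
    fun β ih => Y β fun α => if hα : α < β then ih α hα else 0
  have hy : ∀ β, a * c β = h (tr β y) + y β * h (1 - tr β 1) := by
    intro β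
    have e1 : y β = Y β fun α => if α < β then y α else 0 := by
      simp only [y]
      rw [WellFounded.fix_eq]
      simp
    have e2 : tr β (fun α => if α < β then y α else 0) = tr β y := by
      funext α
      simp only [tr]
      split_ifs <;> rfl
    have := hY β fun α => if α < β then y α else 0
    rwa [e2, ← e1] at this
  have hcoh : ∀ α β, β ≤ α → r β ∣ y α - y β := by
    intro α
    induction α using WellFoundedLT.induction with
    | ind α ih =>
      intro β hβ
      have hz : ∀ γ, ∃ k, γ < α → β ≤ γ → y γ - y β = r β * k := by
        intro γ
        by_cases hγ : γ < α ∧ β ≤ γ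
        · obtain ⟨k, hk⟩ := ih γ hγ.1 β hγ.2
          exact ⟨k, fun _ _ => hk⟩
        · exact ⟨0, fun h1 h2 => (hγ ⟨h1, h2⟩).elim⟩
      choose k hk using hz
      obtain ⟨p, -, hpe⟩ := htr α fun γ => if γ < β then 0 else k γ
      obtain ⟨q, ⟨q, rfl⟩, hqe⟩ := hun α
      have e : tr α y - tr β y - y β • (1 - tr β 1) + y β • (1 - tr α 1)
          = r β • tr α fun γ => if γ < β then 0 else k γ := by
        funext γ
        simp only [tr, Pi.add_apply, Pi.sub_apply, Pi.smul_apply, smul_eq_mul, Pi.one_apply]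
        by_cases h1 : γ < β
        · simp [h1, h1.trans_le hβ]
        · by_cases h2 : γ < α
          · simp [h1, h2, ← hk γ h2 (not_lt.1 h1)]
          · simp [h1, h2]
      have e' := congrArg h e
      simp only [map_add, map_sub, map_smul, smul_eq_mul] at e'
      rw [hpe] at e'
      obtain ⟨m, hm⟩ := hc α β hβ
      have hα := hy α
      have hβ' := hy β
      simp only [map_sub] at hα hβ' hqe
      have key : a * (↑q * (y α - y β)) = a * (r β * (m - p)) := by
        linear_combination a * hm - hα + hβ' - e' - (y α - y β) * hqe
      have key' := mul_left_cancel₀ ha key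
      exact (Units.dvd_mul_left (u := q)).1 ⟨m - p, key'⟩
  refine ⟨y, fun β => ?_⟩
  have hz : ∀ γ, ∃ k, β ≤ γ → y γ - y β = r β * k := by
    intro γ
    by_cases hγ : β ≤ γ
    · obtain ⟨k, hk⟩ := hcoh γ β hγ
      exact ⟨k, fun _ => hk⟩
    · exact ⟨0, fun h1 => (hγ h1).elim⟩
  choose k hk using hz
  refine ⟨fun γ => if γ < β then 0 else k γ, ?_⟩
  have e : y - tr β y - y β • (1 - tr β 1) = r β • fun γ => if γ < β then 0 else k γ := by
    funext γ
    simp only [tr, Pi.sub_apply, Pi.smul_apply, smul_eq_mul, Pi.one_apply]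
    by_cases h1 : γ < β
    · simp [h1]
    · simp [h1, ← hk γ (not_lt.1 h1)]
  have e' := congrArg h e
  simp only [map_sub, map_smul, smul_eq_mul] at e'
  have hβ' := hy β
  simp only [map_sub] at hβ'
  linear_combination e' - hβ'

/-- The submodule of all elements with a nonzero multiple in `R x`. -/
def pureClosure {R M : Type*} [CommRing R] [IsDomain R] [AddCommGroup M] [Module R M]
    (x : M) : Submodule R M where
  carrier := {v | ∃ s t : R, s ≠ 0 ∧ s • v = t • x}
  add_mem' := by
    rintro v w ⟨s, t, hs, h⟩ ⟨s', t', hs', h'⟩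
    refine ⟨s * s', t * s' + t' * s, mul_ne_zero hs hs', ?_⟩
    rw [smul_add, mul_comm s s', mul_smul, h, mul_comm s' s, mul_smul s s', h']
    module
  zero_mem' := ⟨1, 0, one_ne_zero, by simp⟩
  smul_mem' := by
    rintro k v ⟨s, t, hs, h⟩
    refine ⟨s, k * t, hs, ?_⟩
    rw [smul_comm, h, mul_smul]

theorem isPureSub_pureClosure {R M : Type*} [CommRing R] [IsDomain R] [AddCommGroup M]
    [Module R M] (x : M) : IsPureSub R (pureClosure (R := R) x) := by
  rintro r v ⟨s, t, hs, h⟩ ⟨m, rfl⟩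
  by_cases hr : r = 0
  · exact ⟨0, zero_mem _, by simp [hr]⟩
  · exact ⟨m, ⟨s * r, t, mul_ne_zero hs hr, by rw [mul_smul, h]⟩, rfl⟩

theorem isUniserialSub_pureClosure {R M : Type*} [CommRing R] [IsDomain R] [ValuationRing R]
    [AddCommGroup M] [Module R M] [Module.IsTorsionFree R M] (x : M) :
    IsUniserialSub R (pureClosure (R := R) x) := by
  have key : ∀ v w : pureClosure (R := R) x, (∃ k : R, w = k • v) ∨ ∃ k : R, v = k • w := by
    rintro ⟨v, s, t, hs, h⟩ ⟨w, s', t', hs', h'⟩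
    have e1 : (s * s') • v = (t * s') • x := by
      rw [mul_comm s, mul_smul, h, smul_smul, mul_comm]
    have e2 : (s * s') • w = (t' * s) • x := by rw [mul_smul, h', smul_smul, mul_comm]
    have hss := mul_ne_zero hs hs'
    rcases ValuationRing.dvd_total (t * s') (t' * s) with ⟨k, hk⟩ | ⟨k, hk⟩
    · refine Or.inl ⟨k, Subtype.ext (smul_right_injective M hss ?_)⟩
      change (s * s') • w = (s * s') • (k • v)
      rw [smul_comm, e1, e2, hk, smul_smul, mul_comm]
    · refine Or.inr ⟨k, Subtype.ext (smul_right_injective M hss ?_)⟩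
      change (s * s') • v = (s * s') • (k • w)
      rw [smul_comm, e1, e2, hk, smul_smul, mul_comm]
  intro A B
  by_cases hAB : A ≤ B
  · exact Or.inl hAB
  obtain ⟨v, hvA, hvB⟩ := SetLike.not_le_iff_exists.1 hAB
  refine Or.inr fun w hw => ?_
  rcases key v w with ⟨k, rfl⟩ | ⟨k, rfl⟩
  · exact A.smul_mem k hvA
  · exact (hvB (B.smul_mem k hw)).elim

/-- Separability of `R ^ R` yields a functional attached to each chain of principal ideals
without a largest member. -/
theorem exists_functional_of_isSeparableMod {R : Type*} [CommRing R] [IsDomain R]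
    [ValuationRing R] (hsep : IsSeparableMod R (R → R))
    {κ : Type*} [LinearOrder κ] [NoMaxOrder κ] [Nonempty κ] (x : κ → R) (hx0 : ∀ α, x α ≠ 0)
    (hx : ∀ α β, α < β → ∃ p, ¬ IsUnit p ∧ x α = p * x β) :
    ∃ (h : (κ → R) →ₗ[R] R) (a : R), a ≠ 0 ∧ h 1 = a ∧ (∀ z β, a ∣ h z * x β) ∧
      ∀ z β, (∀ α, β ≤ α → z α = 0) → ∃ p, ¬ IsUnit p ∧ h z = a * p := by
  have hdvd : ∀ α β, α ≤ β → x β ∣ x α := by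
    intro α β hαβ
    rcases hαβ.eq_or_lt with rfl | hlt
    · exact dvd_rfl
    · obtain ⟨p, -, hp⟩ := hx α β hlt
      exact ⟨p, by rw [hp, mul_comm]⟩
  have hinj : Function.Injective x := by
    have aux : ∀ α β, α < β → x α ≠ x β := by
      intro α β hlt he
      obtain ⟨p, hp, hpe⟩ := hx α β hlt
      rw [he] at hpe
      have : p = 1 := by
        apply mul_right_cancel₀ (hx0 β)
        rw [← hpe, one_mul]
      exact hp (this ▸ isUnit_one)
    intro α β he
    rcases lt_trichotomy α β with hlt | rfl | hlt
    · exact (aux _ _ hlt he).elim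
    · rfl
    · exact (aux _ _ hlt he.symm).elim
  let E : (κ → R) →ₗ[R] (R → R) := Function.ExtendByZero.linearMap R x
  have hE : ∀ z α, E z (x α) = z α := fun z α => hinj.extend_apply _ _ _
  obtain ⟨V, hV⟩ := hsep (pureClosure (E x)) (isPureSub_pureClosure _)
    (isUniserialSub_pureClosure _)
  let f := Submodule.projectionOnto _ _ hV
  obtain ⟨o⟩ := ‹Nonempty κ›
  have hf : ∀ v β, (f v : R → R) (x o) * x β = x o * (f v : R → R) (x β) := by
    intro v β
    obtain ⟨s, t, hs, hst⟩ := (f v).2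
    have e1 := congrFun hst (x o)
    have e2 := congrFun hst (x β)
    simp only [Pi.smul_apply, smul_eq_mul, hE] at e1 e2
    apply mul_left_cancel₀ hs
    linear_combination x β * e1 - x o * e2
  have hfx : (f (E x) : R → R) = E x := by
    have hm : E x ∈ pureClosure (R := R) (E x) := ⟨1, 1, one_ne_zero, rfl⟩
    exact congrArg Subtype.val (Submodule.projectionOnto_apply_left hV ⟨E x, hm⟩)
  let h : (κ → R) →ₗ[R] R :=
    LinearMap.proj (x o) ∘ₗ (pureClosure (E x)).subtype ∘ₗ f ∘ₗ E ∘ₗ LinearMap.mulLeft R x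
  have hh : ∀ z, h z = (f (E (x * z)) : R → R) (x o) := fun z => rfl
  refine ⟨h, x o, hx0 o, ?_, fun z β => ⟨_, hf _ β⟩, fun z β hz => ?_⟩
  · rw [hh, mul_one, hfx, hE]
  · have hk : ∀ α, ∃ k, x α * z α = x β * k := by
      intro α
      by_cases hα : β ≤ α
      · exact ⟨0, by simp [hz α hα]⟩
      · obtain ⟨k, hk⟩ := hdvd α β (not_le.1 hα).le
        exact ⟨k * z α, by rw [hk, mul_assoc]⟩
    choose k hk using hk
    obtain ⟨γ, hγ⟩ := exists_gt β
    obtain ⟨p, hp, hpe⟩ := hx β γ hγ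
    refine ⟨p * (f (E k) : R → R) (x γ), fun hu => hp (isUnit_of_mul_isUnit_left hu), ?_⟩
    have e : x * z = x β • k := funext hk
    rw [hh, e, map_smul, map_smul, Submodule.coe_smul, Pi.smul_apply, smul_eq_mul, hpe]
    linear_combination p * hf (E k) γ

theorem exists_limit_of_chain {R : Type*} [CommRing R] [IsDomain R]
    [ValuationRing R] (hsep : IsSeparableMod R (R → R))
    {κ : Type*} [LinearOrder κ] [WellFoundedLT κ] [NoMaxOrder κ] [Nonempty κ]
    (x : κ → R) (hx0 : ∀ α, x α ≠ 0)
    (hx : ∀ α β, α < β → ∃ p, ¬ IsUnit p ∧ x α = p * x β)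
    (c r : κ → R) (hc : ∀ α β, β ≤ α → r β ∣ c α - c β)
    (hxr : ∀ α, ∃ β γ, α ≤ β ∧ ¬ r β ∣ x γ * r α) :
    ∃ d, ∀ α, r α ∣ d - c α := by
  obtain ⟨h, a, ha, h1, hdiv, hb⟩ := exists_functional_of_isSeparableMod hsep x hx0 hx
  obtain ⟨y, hy⟩ := exists_map_eq_of_coherent h a ha h1 hb c r hc
  have key : ∀ α, a * r α ∣ h y - a * c α := by
    intro α
    by_contra hcon
    obtain ⟨β, γ, hαβ, hn⟩ := hxr α
    have h2 : ¬ a * r α ∣ h y - a * c β := by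
      intro h3
      apply hcon
      have := dvd_add h3 (mul_dvd_mul_left a (hc β α hαβ))
      convert this using 1
      ring
    have h3 := (ValuationRing.dvd_total _ _).resolve_left h2
    obtain ⟨w, hw⟩ := hy β
    have h4 : a * r β ∣ (h y - a * c β) * x γ := by
      rw [hw, mul_comm a, mul_assoc]
      exact mul_dvd_mul_left _ (hdiv w γ)
    have h5 := h4.trans (mul_dvd_mul_right h3 (x γ))
    rw [mul_assoc, mul_comm (r α)] at h5
    exact hn ((mul_dvd_mul_iff_left ha).1 h5)
  obtain ⟨o⟩ := ‹Nonempty κ›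
  have : a ∣ h y := by
    have h1 := (Dvd.intro _ rfl : a ∣ a * r o).trans (key o)
    exact (dvd_sub_left (Dvd.intro _ rfl)).1 h1
  obtain ⟨d, hd⟩ := this
  refine ⟨d, fun α => (mul_dvd_mul_iff_left ha).1 ?_⟩
  rw [mul_sub, ← hd]
  exact key α

/-- Limits exist modulo an ideal `I` whose colon ideals `(I : r)`, `r ∉ I`, have no largest
member. -/
theorem exists_limit_of_colon_unbounded {R : Type*} [CommRing R] [IsDomain R]
    [ValuationRing R] (hsep : IsSeparableMod R (R → R)) (I : Ideal R) (hI : I ≠ ⊤)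
    (hcol : ∀ u ∉ I, ∃ u' ∉ I, ∃ x, x * u' ∈ I ∧ x * u ∉ I)
    (c : R → R) (hc : ∀ r ∉ I, ∀ r' ∉ I, r ∣ r' → r ∣ c r' - c r) :
    ∃ d, ∀ r ∉ I, r ∣ d - c r := by
  let T := {r : R // r ∉ I}
  let lt' : T → T → Prop := fun s t => ∃ x, x * t.1 ∈ I ∧ x * s.1 ∉ I
  have hmul : ∀ {x y t : R}, x ∣ y → x * t ∈ I → y * t ∈ I := by
    rintro x y t ⟨k, rfl⟩ h
    have := I.mul_mem_left k h
    rwa [← mul_assoc, mul_comm k] at this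
  have hmono : ∀ {s t : T} {x : R}, lt' s t → x * s.1 ∈ I → x * t.1 ∈ I := by
    rintro s t x ⟨y, hyt, hys⟩ hx
    rcases ValuationRing.dvd_total x y with h | h
    · exact (hys (hmul h hx)).elim
    · exact hmul h hyt
  have hnlt : ∀ {s t u : T}, lt' s u → ¬ lt' t u → lt' s t := by
    rintro s t u ⟨x, hxu, hxs⟩ hn
    exact ⟨x, by_contra fun h => hn ⟨x, hxu, h⟩, hxs⟩
  have hirr : ∀ t, ¬ lt' t t := fun t ⟨x, h1, h2⟩ => h2 h1
  have hasymm : ∀ {s t}, lt' s t → ¬ lt' t s := by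
    rintro s t h ⟨x, h1, h2⟩
    exact h2 (hmono h h1)
  have hndvd : ∀ {s t : T}, lt' s t → ¬ t.1 ∣ s.1 := by
    rintro s t ⟨x, h1, h2⟩ ⟨k, hk⟩
    apply h2
    rw [hk, ← mul_assoc]
    exact I.mul_mem_right k h1
  let _ : LinearOrder T := IsWellOrder.linearOrder WellOrderingRel
  have hwf : WellFoundedLT T := ⟨(WellOrderingRel.isWellOrder (α := T)).wf⟩
  let κ := {t : T // ∀ s, s < t → lt' s t}
  have hlt : ∀ {α β : κ}, α < β → lt' α.1 β.1 := fun {α β} h => β.2 α.1 h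
  have hlt_iff : ∀ {α β : κ}, lt' α.1 β.1 → α < β := by
    intro α β h
    rcases lt_trichotomy α β with h1 | rfl | h1
    · exact h1
    · exact (hirr _ h).elim
    · exact (hasymm h (hlt h1)).elim
  have hcof : ∀ t : T, ∃ w : κ, lt' t w.1 := by
    intro t
    obtain ⟨u, hu, hx⟩ := hcol t.1 t.2
    have htu : lt' t ⟨u, hu⟩ := hx
    obtain ⟨w, hw, hmin⟩ := hwf.wf.has_min {w : T | ¬ lt' w ⟨u, hu⟩} ⟨_, hirr _⟩
    refine ⟨⟨w, fun s hs => hnlt (by_contra fun h => hmin s h hs) hw⟩, hnlt htu hw⟩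
  have hne : Nonempty κ := ⟨(hcof ⟨1, fun h => hI ((Ideal.eq_top_iff_one I).2 h)⟩).choose⟩
  have hnomax : NoMaxOrder κ := ⟨fun α => (hcof α.1).imp fun w hw => hlt_iff hw⟩
  have hx : ∀ α : κ, ∃ x, x * α.1.1 ∉ I ∧ ∀ β, α < β → x * β.1.1 ∈ I := by
    intro α
    obtain ⟨w, hw, hmin⟩ := (wellFounded_lt (α := κ)).has_min {β | α < β} (exists_gt α)
    obtain ⟨x, hxw, hxα⟩ := hlt hw
    refine ⟨x, hxα, fun β hβ => ?_⟩
    rcases (not_lt.1 (hmin β hβ)).eq_or_lt with rfl | h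
    · exact hxw
    · exact hmono (hlt h) hxw
  choose x hxn hxm using hx
  have hdvd : ∀ {s t : T}, lt' s t → s.1 ∣ t.1 := fun h =>
    (ValuationRing.dvd_total _ _).resolve_right (hndvd h)
  have hdvd' : ∀ {α β : κ}, α ≤ β → α.1.1 ∣ β.1.1 := by
    intro α β h
    rcases h.eq_or_lt with rfl | h
    · exact dvd_rfl
    · exact hdvd (hlt h)
  obtain ⟨d, hd⟩ := exists_limit_of_chain hsep x
    (fun α h => hxn α (by rw [h, zero_mul]; exact I.zero_mem))
    (fun α β h => by
      have h1 : ¬ x α ∣ x β := fun hdv => hxn β (hmul hdv (hxm α β h))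
      obtain ⟨p, hp⟩ := (ValuationRing.dvd_total _ _).resolve_left h1
      refine ⟨p, fun hu => h1 ?_, by rw [hp, mul_comm]⟩
      rw [hp]
      exact (hu.mul_right_dvd).2 dvd_rfl)
    (fun α => c α.1.1) (fun α => α.1.1) (fun α β h => hc _ β.1.2 _ α.1.2 (hdvd' h))
    (fun α => by
      obtain ⟨β, hβ⟩ := hcof ⟨x α * α.1.1, hxn α⟩
      refine ⟨β, α, ?_, hndvd hβ⟩
      by_contra h
      exact hndvd hβ ((hdvd' (not_le.1 h).le).mul_left _))
  refine ⟨d, fun r hr => ?_⟩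
  obtain ⟨w, hw⟩ := hcof ⟨r, hr⟩
  have h1 := (hdvd hw).trans (hd w)
  have h2 := hc r hr _ w.1.2 (hdvd hw)
  convert dvd_add h1 h2 using 1
  ring

/-- A countable generating set of `R_L` gives a divisibility chain cofinal in the complement
of `L`. -/
theorem exists_cofinal_seq_of_countable_span {R : Type*} [CommRing R] [IsDomain R]
    [ValuationRing R] (L : Ideal R) [L.IsPrime]
    (hcg : ∃ S : Set (Localization.AtPrime L), S.Countable ∧ Submodule.span R S = ⊤) :
    ∃ σ : ℕ → R, (∀ n, σ n ∉ L) ∧ (∀ m n, m ≤ n → σ m ∣ σ n) ∧ ∀ s ∉ L, ∃ n, s ∣ σ n := by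
  obtain ⟨S, hS, hspan⟩ := hcg
  have hrep : ∀ z : Localization.AtPrime L, ∃ t ∉ L, ∃ b,
      algebraMap R _ t * z = algebraMap R _ b := by
    intro z
    obtain ⟨⟨b, t⟩, h⟩ := IsLocalization.surj L.primeCompl z
    exact ⟨t, t.2, b, by rw [mul_comm]; exact h⟩
  choose den hden num hnum using hrep
  obtain ⟨g, hg⟩ := (hS.insert 0).exists_eq_range (Set.insert_nonempty 0 S)
  let σ : ℕ → R := fun n => ∏ i ∈ Finset.range n, den (g i)
  have hσd : ∀ m n, m ≤ n → σ m ∣ σ n := fun m n h =>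
    Finset.prod_dvd_prod_of_subset _ _ _ (Finset.range_mono h)
  have hσL : ∀ n, σ n ∉ L := fun n =>
    prod_mem (S := L.primeCompl) fun i _ => hden (g i)
  have hall : ∀ z : Localization.AtPrime L, ∃ n b, algebraMap R _ (σ n) * z = algebraMap R _ b := by
    intro z
    have hz : z ∈ Submodule.span R S := hspan ▸ Submodule.mem_top
    induction hz using Submodule.span_induction with
    | mem z hz =>
      obtain ⟨i, rfl⟩ : z ∈ Set.range g := hg ▸ Set.mem_insert_of_mem _ hz
      refine ⟨i + 1, σ i * num (g i), ?_⟩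
      have : σ (i + 1) = σ i * den (g i) := Finset.prod_range_succ _ _
      rw [this, map_mul, map_mul, mul_assoc, hnum]
    | zero => exact ⟨0, 0, by simp⟩
    | add z w _ _ hz hw =>
      obtain ⟨m, b, hb⟩ := hz
      obtain ⟨n, b', hb'⟩ := hw
      obtain ⟨k, hk⟩ := hσd m _ (le_max_left m n)
      obtain ⟨k', hk'⟩ := hσd n _ (le_max_right m n)
      refine ⟨max m n, k * b + k' * b', ?_⟩
      rw [mul_add, map_add, map_mul, map_mul, ← hb, ← hb']
      nth_rw 1 [hk]
      rw [hk', map_mul, map_mul]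
      ring
    | smul a z _ hz =>
      obtain ⟨n, b, hb⟩ := hz
      exact ⟨n, a * b, by rw [map_mul, ← hb, Algebra.smul_def]; ring⟩
  refine ⟨σ, hσL, hσd, fun s hs => ?_⟩
  obtain ⟨n, b, hb⟩ := hall (IsLocalization.mk' _ (1 : R) (⟨s, hs⟩ : L.primeCompl))
  refine ⟨n, b, ?_⟩
  apply IsLocalization.injective (Localization.AtPrime L) L.primeCompl_le_nonZeroDivisors
  rw [map_mul, ← hb, mul_left_comm]
  have := IsLocalization.mk'_spec' (Localization.AtPrime L) (1 : R) (⟨s, hs⟩ : L.primeCompl)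
  simp only [map_one] at this
  rw [this, mul_one]

/-- Limits exist modulo an ideal `I` one of whose colon ideals `(I : r)`, `r ∉ I`, is largest. -/
theorem exists_limit_of_colon_bounded {R : Type*} [CommRing R] [IsDomain R]
    [ValuationRing R] (hsep : IsSeparableMod R (R → R))
    (hcg : ∀ (L : Ideal R) [L.IsPrime],
      ∃ S : Set (Localization.AtPrime L), S.Countable ∧ Submodule.span R S = ⊤)
    (J : Ideal R) (hJ1 : J ≠ ⊤) (hJ : ∀ u ∈ J, ∃ v ∈ J, ∃ p, ¬ IsUnit p ∧ u = p * v)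
    (I : Ideal R) (hIJ : ∀ r ∉ I, ∃ m ∈ J, r * m ∉ I) (r₀ : R) (hr₀ : r₀ ∉ I)
    (hcol : ∀ u ∉ I, ∀ x, x * u ∈ I → x * r₀ ∈ I)
    (c : R → R) (hc : ∀ r ∉ I, ∀ r' ∉ I, r ∣ r' → r ∣ c r' - c r) :
    ∃ d, ∀ r ∉ I, r ∣ d - c r := by
  let L : Ideal R := Submodule.comap (LinearMap.mulRight R r₀) I
  have hL : ∀ x, x ∈ L ↔ x * r₀ ∈ I := fun x => Iff.rfl
  have hLp : L.IsPrime := by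
    refine ⟨fun h => hr₀ ?_, fun {x y} hxy => ?_⟩
    · have := (hL 1).1 (h ▸ Submodule.mem_top)
      rwa [one_mul] at this
    · rw [hL, mul_assoc] at hxy
      rw [hL, hL]
      by_contra! hn
      exact hn.1 (hcol _ hn.2 x hxy)
  obtain ⟨σ, hσL, hσd, hσ⟩ := exists_cofinal_seq_of_countable_span L (hcg L)
  obtain ⟨m, hmJ, hm⟩ := hIJ r₀ hr₀
  have hx : ∃ x : ℕ → J, x 0 = ⟨m, hmJ⟩ ∧
      ∀ n, ∃ p, ¬ IsUnit p ∧ (x n : R) = p * (x (n + 1) : R) := by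
    have hstep : ∀ u : J, ∃ v : J, ∃ p, ¬ IsUnit p ∧ (u : R) = p * v := fun u => by
      obtain ⟨v, hv, h⟩ := hJ u.1 u.2
      exact ⟨⟨v, hv⟩, h⟩
    choose N hN using hstep
    exact ⟨fun n => Nat.rec ⟨m, hmJ⟩ (fun _ u => N u) n, rfl, fun n => hN _⟩
  obtain ⟨x, hx0, hxs⟩ := hx
  have hm0 : m ≠ 0 := by
    rintro rfl
    exact hm (by rw [mul_zero]; exact I.zero_mem)
  have hxne : ∀ n, (x n : R) ≠ 0 := by
    intro n
    induction n with
    | zero => rw [hx0]; exact hm0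
    | succ n ih =>
      intro h
      obtain ⟨p, -, hp⟩ := hxs n
      exact ih (by rw [hp, h, mul_zero])
  have hrI : ∀ n, r₀ * σ n ∉ I := fun n h => hσL n ((hL _).2 (by rwa [mul_comm]))
  have hrd : ∀ k n, k ≤ n → r₀ * σ k ∣ r₀ * σ n := fun k n h => mul_dvd_mul_left _ (hσd k n h)
  have hcof : ∀ t ∉ I, ∃ n, t ∣ r₀ * σ n := by
    intro t ht
    rcases ValuationRing.dvd_total t r₀ with h | ⟨s, rfl⟩
    · exact ⟨0, h.mul_right _⟩
    · obtain ⟨n, hn⟩ := hσ s fun h => ht (by rw [mul_comm]; exact (hL s).1 h)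
      exact ⟨n, mul_dvd_mul_left _ hn⟩
  have hcof' : ∀ t ∉ I, ∃ n, ¬ r₀ * σ n ∣ t := by
    intro t ht
    obtain ⟨j, hj, hjt⟩ := hIJ t ht
    obtain ⟨n, hn⟩ := hcof _ hjt
    refine ⟨n, fun h => ?_⟩
    have ht0 : t ≠ 0 := by
      rintro rfl
      exact ht I.zero_mem
    have h1 : t * j ∣ t * 1 := by
      rw [mul_one]
      exact hn.trans h
    exact hJ1 (Ideal.eq_top_of_isUnit_mem J hj
      (isUnit_of_dvd_one ((mul_dvd_mul_iff_left ht0).1 h1)))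
  obtain ⟨d, hd⟩ := exists_limit_of_chain hsep (fun n => (x n : R)) hxne
    (fun a b h => by
      induction b, h using Nat.le_induction with
      | base => exact hxs a
      | succ n hn ih =>
        obtain ⟨p, hp, hpe⟩ := ih
        obtain ⟨q, hq, hqe⟩ := hxs n
        exact ⟨p * q, fun hu => hp (isUnit_of_mul_isUnit_left hu), by rw [hpe, hqe, mul_assoc]⟩)
    (fun n => c (r₀ * σ n)) (fun n => r₀ * σ n)
    (fun a b h => hc _ (hrI b) _ (hrI a) (hrd b a h))
    (fun n => by
      obtain ⟨k, hk⟩ := hcof' ((x 0 : R) * (r₀ * σ n)) fun h => by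
        rw [hx0] at h
        exact hm (by rw [mul_comm]; exact hcol _ (hrI n) _ h)
      exact ⟨max n k, 0, le_max_left _ _, fun h => hk ((hrd k _ (le_max_right _ _)).trans h)⟩)
  refine ⟨d, fun r hr => ?_⟩
  obtain ⟨n, hn⟩ := hcof r hr
  convert dvd_add (hn.trans (hd n)) (hc r hr _ (hrI n) hn) using 1
  ring

/-- A coherent family of cosets of ideals saturated at `J` has a common point. -/
theorem exists_mem_of_coherent_of_isSeparableMod {R : Type*} [CommRing R] [IsDomain R]
    [ValuationRing R] (hsep : IsSeparableMod R (R → R))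
    (hcg : ∀ (L : Ideal R) [L.IsPrime],
      ∃ S : Set (Localization.AtPrime L), S.Countable ∧ Submodule.span R S = ⊤)
    (J : Ideal R) (hJ1 : J ≠ ⊤) (hJ : ∀ u ∈ J, ∃ v ∈ J, ∃ p, ¬ IsUnit p ∧ u = p * v)
    {ι : Type*} (a : ι → R) (B : ι → Ideal R)
    (hsat : ∀ i, ∀ s ∉ J, ∀ r, r * s ∈ B i → r ∈ B i)
    (hab : ∀ i j, B i ≤ B j → a i - a j ∈ B j) (hmin : ∀ i, ∃ r ∈ B i, r ∉ ⨅ i, B i) :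
    ∃ d, ∀ i, d - a i ∈ B i := by
  set I := ⨅ i, B i with hI
  by_cases hItop : I = ⊤
  · exact ⟨0, fun i => by
      have := iInf_le B i
      rw [← hI, hItop, top_le_iff] at this
      rw [this]
      trivial⟩
  have hex : ∀ r, ∃ i, r ∉ I → r ∉ B i := by
    have : Nonempty ι := by
      by_contra hn
      rw [not_nonempty_iff] at hn
      exact hItop (iInf_of_empty B)
    intro r
    by_cases hr : r ∈ I
    · exact ⟨Classical.arbitrary ι, fun h => (h hr).elim⟩
    · rw [hI, Submodule.mem_iInf] at hr
      push Not at hr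
      exact hr.imp fun i h _ => h
  choose i hi using hex
  have hB : ∀ {j r b}, r ∉ B j → b ∈ B j → r ∣ b := fun {j r b} hr hb =>
    (ValuationRing.dvd_total r b).resolve_right fun h => hr (Ideal.mem_of_dvd _ h hb)
  have hle : ∀ j k, a j - a k ∈ B j ∨ a j - a k ∈ B k := by
    intro j k
    rcases (ValuationRing.le_total_ideal (A := R)).total (B j) (B k) with h | h
    · exact Or.inr (hab j k h)
    · left
      rw [← neg_sub]
      exact (B j).neg_mem (hab k j h)
  have hc : ∀ r ∉ I, ∀ r' ∉ I, r ∣ r' → r ∣ a (i r') - a (i r) := by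
    intro r hr r' hr' hd
    rcases hle (i r') (i r) with h | h
    · exact hd.trans (hB (hi r' hr') h)
    · exact hB (hi r hr) h
  have hIJ : ∀ r ∉ I, ∃ m ∈ J, r * m ∉ I := by
    intro r hr
    obtain ⟨r', hr', hr'I⟩ := hmin (i r)
    obtain ⟨m, rfl⟩ := hB (hi r hr) hr'
    exact ⟨m, by_contra fun hm => hi r hr (hsat _ m hm r hr'), hr'I⟩
  obtain ⟨d, hd⟩ : ∃ d, ∀ r ∉ I, r ∣ d - a (i r) := by
    by_cases hcol : ∀ u ∉ I, ∃ u' ∉ I, ∃ x, x * u' ∈ I ∧ x * u ∉ I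
    · exact exists_limit_of_colon_unbounded hsep I hItop hcol _ hc
    · push Not at hcol
      obtain ⟨r₀, hr₀, hcol⟩ := hcol
      exact exists_limit_of_colon_bounded hsep hcg J hJ1 hJ I hIJ r₀ hr₀ hcol _ hc
  refine ⟨d, fun j => ?_⟩
  obtain ⟨r, hr, hrI⟩ := hmin j
  have h1 : d - a (i r) ∈ B j := Ideal.mem_of_dvd _ (hd r hrI) hr
  have h2 : a (i r) - a j ∈ B j := by
    rcases hle (i r) j with h | h
    · exact Ideal.mem_of_dvd _ (hB (hi r hrI) h) hr
    · exact h
  simpa using (B j).add_mem h1 h2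

theorem dvd_total_localization {R : Type*} [CommRing R] [IsDomain R] [ValuationRing R]
    (J : Ideal R) [J.IsPrime] (z w : Localization.AtPrime J) : z ∣ w ∨ w ∣ z := by
  obtain ⟨⟨b, s⟩, h⟩ := IsLocalization.surj J.primeCompl z
  obtain ⟨⟨b', s'⟩, h'⟩ := IsLocalization.surj J.primeCompl w
  have hs := IsLocalization.map_units (Localization.AtPrime J) s
  have hs' := IsLocalization.map_units (Localization.AtPrime J) s'
  have key : ∀ {x y : R}, x ∣ y → algebraMap R (Localization.AtPrime J) x ∣ algebraMap R _ y :=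
    fun hd => map_dvd _ hd
  rcases ValuationRing.dvd_total b b' with hd | hd
  · have := key hd
    rw [← h, ← h', hs'.dvd_mul_right, hs.mul_right_dvd] at this
    exact Or.inl this
  · have := key hd
    rw [← h, ← h', hs.dvd_mul_right, hs'.mul_right_dvd] at this
    exact Or.inr this

/-- Elements of the maximal ideal of `R_J` come from `J`. -/
theorem exists_algebraMap_eq_of_mem_maximalIdeal {R : Type*} [CommRing R] [IsDomain R]
    [ValuationRing R] (J : Ideal R) [J.IsPrime] (z : Localization.AtPrime J)
    (hz : z ∈ IsLocalRing.maximalIdeal (Localization.AtPrime J)) :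
    ∃ b, algebraMap R _ b = z := by
  obtain ⟨⟨b, s⟩, h⟩ := IsLocalization.surj J.primeCompl z
  have hs := IsLocalization.map_units (Localization.AtPrime J) s
  have hbJ : b ∈ J := by
    rw [← IsLocalization.AtPrime.to_map_mem_maximal_iff (Localization.AtPrime J) J, ← h]
    exact Ideal.mul_mem_right _ _ hz
  rcases ValuationRing.dvd_total b s with hd | ⟨k, hk⟩
  · exact (s.2 (Ideal.mem_of_dvd _ hd hbJ)).elim
  · refine ⟨k, hs.mul_right_cancel ?_⟩
    change z * algebraMap R _ s = algebraMap R _ b at h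
    rw [h, hk, map_mul, mul_comm]

theorem isMaximalVD_of_isSeparableMod {R : Type*} [CommRing R] [IsDomain R]
    [ValuationRing R] (hsep : IsSeparableMod R (R → R))
    (hcg : ∀ (L : Ideal R) [L.IsPrime],
      ∃ S : Set (Localization.AtPrime L), S.Countable ∧ Submodule.span R S = ⊤)
    (J : Ideal R) [J.IsPrime] (hJ : ∀ u ∈ J, ∃ v ∈ J, ∃ p, ¬ IsUnit p ∧ u = p * v) :
    IsMaximalVD (Localization.AtPrime J)
        (IsLocalRing.maximalIdeal (Localization.AtPrime J)) := by
  intro A hA _ ι a B _ hab hinf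
  by_cases hmin : ∃ i, B i ≤ A
  · obtain ⟨i, hi⟩ := hmin
    exact ⟨a i, fun j => hab i j (hi.trans (hinf ▸ iInf_le B j))⟩
  push Not at hmin
  obtain ⟨o, ho⟩ : ∃ o, B o ≠ ⊤ := by
    by_contra! h
    exact hA (by rw [← hinf]; simp [h])
  have hom : B o ≤ IsLocalRing.maximalIdeal (Localization.AtPrime J) :=
    IsLocalRing.le_maximalIdeal ho
  let ι' := {i // B i ≤ B o}
  have hb : ∀ i : ι', ∃ b : R, algebraMap R _ b = a i - a o := fun i =>
    exists_algebraMap_eq_of_mem_maximalIdeal J _ (hom (hab i o i.2))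
  choose b hb using hb
  have htot : ∀ i j, B i ≤ B j ∨ B j ≤ B i := by
    intro i j
    by_cases h : B i ≤ B j
    · exact Or.inl h
    obtain ⟨z, hzi, hzj⟩ := SetLike.not_le_iff_exists.1 h
    refine Or.inr fun w hw => ?_
    rcases dvd_total_localization J z w with hd | hd
    · exact Ideal.mem_of_dvd _ hd hzi
    · exact (hzj (Ideal.mem_of_dvd _ hd hw)).elim
  let B' : ι' → Ideal R := fun i => (B i).comap (algebraMap R _)
  have hB'inf : ∀ r, r ∈ ⨅ i, B' i → algebraMap R (Localization.AtPrime J) r ∈ A := by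
    intro r hr
    rw [Submodule.mem_iInf] at hr
    rw [← hinf, Submodule.mem_iInf]
    intro i
    rcases htot i o with h | h
    · exact hr ⟨i, h⟩
    · exact h (hr ⟨o, le_rfl⟩)
  have hcomap : ∀ i j, B' i ≤ B' j → B i ≤ B j := fun i j h =>
    (IsLocalization.orderEmbedding J.primeCompl (Localization.AtPrime J)).le_iff_le.1 h
  obtain ⟨d, hd⟩ := exists_mem_of_coherent_of_isSeparableMod hsep hcg J
    (Ideal.IsPrime.ne_top ‹_›) hJ b B'
    (fun i s hs r hr => by
      have hu := IsLocalization.map_units (Localization.AtPrime J) (⟨s, hs⟩ : J.primeCompl)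
      rw [Ideal.mem_comap, map_mul] at hr
      exact (Ideal.mul_unit_mem_iff_mem _ hu).1 hr)
    (fun i j h => by
      rw [Ideal.mem_comap, map_sub, hb, hb, sub_sub_sub_cancel_right]
      exact hab i j (hcomap i j h))
    (fun i => by
      by_contra! hcon
      refine hmin i fun z hz => ?_
      obtain ⟨r, rfl⟩ := exists_algebraMap_eq_of_mem_maximalIdeal J z (hom (i.2 hz))
      exact hB'inf r (hcon r hz))
  have hd' : ∀ i : ι', algebraMap R _ d + a o - a i ∈ B i := by
    intro i
    have := hd i
    rw [Ideal.mem_comap, map_sub, hb] at this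
    convert this using 1
    ring
  refine ⟨algebraMap R _ d + a o, fun i => ?_⟩
  rcases htot i o with h | h
  · exact hd' ⟨i, h⟩
  · have := (B i).add_mem (h (hd' ⟨o, le_rfl⟩)) (hab o i h)
    convert this using 1
    ring

theorem exists_mem_eq_mul_of_not_isPrincipal {R : Type*} [CommRing R] [IsDomain R]
    [ValuationRing R] (P : Ideal R) (hP : P.IsMaximal) (hnp : ¬ P.IsPrincipal) (u : R)
    (hu : u ∈ P) : ∃ v ∈ P, ∃ p ∈ P, u = p * v := by
  have h : ¬ P ≤ Ideal.span {u} := fun h =>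
    hnp ⟨u, le_antisymm h ((Ideal.span_singleton_le_iff_mem _).2 hu)⟩
  obtain ⟨v, hv, hvu⟩ := SetLike.not_le_iff_exists.1 h
  rw [Ideal.mem_span_singleton] at hvu
  obtain ⟨p, hp⟩ := (ValuationRing.dvd_total u v).resolve_left hvu
  refine ⟨v, hv, p, ?_, by rw [hp, mul_comm]⟩
  rw [IsLocalRing.eq_maximalIdeal hP, IsLocalRing.mem_maximalIdeal]
  intro hpu
  apply hvu
  rw [hp]
  exact hpu.mul_right_dvd.2 dvd_rfl

theorem le_pow_of_not_isPrincipal {R : Type*} [CommRing R] [IsDomain R]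
    [ValuationRing R] (P : Ideal R) (hP : P.IsMaximal) (hnp : ¬ P.IsPrincipal) (n : ℕ) :
    P ≤ P ^ n := by
  induction n with
  | zero => simp
  | succ n ih =>
    intro u hu
    obtain ⟨v, hv, p, hp, rfl⟩ := exists_mem_eq_mul_of_not_isPrincipal P hP hnp u hu
    rw [pow_succ]
    exact Ideal.mul_mem_mul (ih hp) hv

/-- Every element of `⋂ Pⁿ` is a proper multiple of an element of `⋂ Pⁿ`. -/
theorem exists_mem_iInf_pow_eq_mul {R : Type*} [CommRing R] [IsDomain R] [ValuationRing R]
    (P : Ideal R) (hP : P.IsMaximal) (u : R) (hu : u ∈ ⨅ n : ℕ, P ^ n) :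
    ∃ v ∈ ⨅ n : ℕ, P ^ n, ∃ p, ¬ IsUnit p ∧ u = p * v := by
  have hu1 : u ∈ P := by simpa using (Submodule.mem_iInf _).1 hu 1
  have hPu : ∀ p ∈ P, ¬ IsUnit p := fun p hp hpu =>
    hP.ne_top (Ideal.eq_top_of_isUnit_mem P hp hpu)
  by_cases hpr : P.IsPrincipal
  · obtain ⟨p, hp⟩ := hpr
    have hp' : P = Ideal.span {p} := hp
    have hpP : p ∈ P := hp' ▸ Ideal.mem_span_singleton_self p
    by_cases hp0 : p = 0
    · refine ⟨0, zero_mem _, p, hPu p hpP, ?_⟩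
      rw [hp', hp0, Ideal.mem_span_singleton, zero_dvd_iff] at hu1
      rw [hu1, mul_zero]
    · rw [hp', Ideal.mem_span_singleton] at hu1
      obtain ⟨v, rfl⟩ := hu1
      refine ⟨v, (Submodule.mem_iInf _).2 fun n => ?_, p, hPu p hpP, rfl⟩
      have h := (Submodule.mem_iInf _).1 hu (n + 1)
      rw [hp', Ideal.span_singleton_pow, Ideal.mem_span_singleton, pow_succ',
        mul_dvd_mul_iff_left hp0] at h
      rwa [hp', Ideal.span_singleton_pow, Ideal.mem_span_singleton]
  · obtain ⟨v, hv, p, hp, rfl⟩ := exists_mem_eq_mul_of_not_isPrincipal P hP hpr u hu1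
    exact ⟨v, (Submodule.mem_iInf _).2 fun n => le_pow_of_not_isPrincipal P hP hpr n hv, p,
      hPu p hp, rfl⟩

/-- A pure submodule that is compact for the cosets of its submodules `t U` is a summand. -/
theorem isSummand_of_coset_compact {R M : Type*} [CommRing R] [IsDomain R] [ValuationRing R]
    [AddCommGroup M] [Module R M] [Module.IsTorsionFree R M] (U : Submodule R M)
    (hU : IsPureSub R U)
    (hcpt : ∀ Λ : Set (R × M), Λ.Nonempty → (∀ p ∈ Λ, p.2 ∈ U) →
      (∀ p ∈ Λ, ∀ q ∈ Λ, q.1 ∣ p.1 → ∃ w ∈ U, p.2 - q.2 = q.1 • w) →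
      ∃ c ∈ U, ∀ p ∈ Λ, ∃ w ∈ U, c - p.2 = p.1 • w) :
    IsSummand R U := by
  let 𝒱 : Set (Submodule R M) :=
    {V | ∀ (r : R) (u v n : M), u ∈ U → v ∈ V → u + v = r • n → ∃ w ∈ U, u = r • w}
  have hbot : (⊥ : Submodule R M) ∈ 𝒱 := by
    intro r u v n hu hv h
    rw [Submodule.mem_bot] at hv
    rw [hv, add_zero] at h
    obtain ⟨w, hw, e⟩ := hU r u hu ⟨n, h.symm⟩
    exact ⟨w, hw, e.symm⟩
  obtain ⟨V, -, hV⟩ := zorn_le_nonempty₀ 𝒱 (fun C hC hchain V₀ hV₀ => by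
    refine ⟨sSup C, ?_, fun V hV => le_sSup hV⟩
    intro r u v n hu hv h
    obtain ⟨V, hVC, hvV⟩ := (Submodule.mem_sSup_of_directed ⟨V₀, hV₀⟩ hchain.directedOn).1 hv
    exact hC hVC r u v n hu hvV h) ⊥ hbot
  have hVmem : V ∈ 𝒱 := hV.prop
  have hsat : ∀ (s : R) (n : M), s ≠ 0 → s • n ∈ V → n ∈ V := by
    let V' : Submodule R M :=
      { carrier := {n | ∃ s : R, s ≠ 0 ∧ s • n ∈ V}
        add_mem' := by
          rintro x y ⟨s, hs, hx⟩ ⟨t, ht, hy⟩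
          refine ⟨s * t, mul_ne_zero hs ht, ?_⟩
          rw [smul_add, mul_comm s t, mul_smul, mul_comm t s, mul_smul]
          exact V.add_mem (V.smul_mem _ hx) (V.smul_mem _ hy)
        zero_mem' := ⟨1, one_ne_zero, by simp⟩
        smul_mem' := by
          rintro k x ⟨s, hs, hx⟩
          refine ⟨s, hs, ?_⟩
          rw [smul_comm]
          exact V.smul_mem _ hx }
    have hV' : V' ∈ 𝒱 := by
      rintro r u v n hu ⟨s, hs, hv⟩ h
      obtain ⟨w, hw, e⟩ := hVmem (s * r) (s • u) (s • v) n (U.smul_mem _ hu) hv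
        (by rw [← smul_add, h, mul_smul])
      rw [mul_smul] at e
      exact ⟨w, hw, smul_right_injective M hs e⟩
    have hle : V ≤ V' := fun v hv => ⟨1, one_ne_zero, by simpa using hv⟩
    exact fun s n hs hn => hV.le_of_ge hV' hle ⟨s, hs, hn⟩
  refine ⟨V, ?_, ?_⟩
  · rw [Submodule.disjoint_def]
    intro u hu hv
    obtain ⟨w, -, e⟩ := hVmem 0 u (-u) 0 hu (V.neg_mem hv) (by simp)
    simpa using e
  · rw [codisjoint_iff, eq_top_iff]
    rintro m -
    obtain ⟨c, hc, hcΛ⟩ := hcpt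
      {p | p.2 ∈ U ∧ ∃ v ∈ V, ∃ n, m - p.2 + v = p.1 • n}
      ⟨(1, 0), U.zero_mem, 0, V.zero_mem, m, by simp⟩ (fun p hp => hp.1)
      (by
        rintro ⟨t, w⟩ ⟨hw, v, hv, n, hn⟩ ⟨t', w'⟩ ⟨hw', v', hv', n', hn'⟩ ⟨k, hk⟩
        simp only at hw hw' hn hn' hk ⊢
        refine hVmem t' (w - w') (v' - v) (n' - k • n) (U.sub_mem hw hw') (V.sub_mem hv' hv) ?_
        rw [smul_sub, smul_smul, ← hk, ← hn, ← hn']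
        abel)
    have hV' : V ⊔ Submodule.span R {m - c} ∈ 𝒱 := by
      intro r u y n hu hy h
      obtain ⟨v, hv, z, hz, rfl⟩ := Submodule.mem_sup.1 hy
      obtain ⟨s, rfl⟩ := Submodule.mem_span_singleton.1 hz
      by_cases hrs : r ∣ s
      · obtain ⟨k, rfl⟩ := hrs
        refine hVmem r u v (n - k • (m - c)) hu hv ?_
        rw [smul_sub, ← h, mul_smul]
        abel
      · obtain ⟨t, rfl⟩ := (ValuationRing.dvd_total r s).resolve_left hrs
        have hs : s ≠ 0 := by
          rintro rfl
          exact hrs (dvd_zero _)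
        have e : u + v = s • (t • n - (m - c)) := by
          rw [smul_sub, smul_smul, ← h]
          abel
        obtain ⟨u₁, hu₁, rfl⟩ := hVmem s u v _ hu hv e
        have e₁ : v = s • (t • n - (m - c) - u₁) := by
          rw [smul_sub, ← e]
          abel
        have hv₁ : t • n - (m - c) - u₁ ∈ V := hsat s _ hs (e₁ ▸ hv)
        obtain ⟨w, hw, e₂⟩ := hcΛ (t, c - u₁)
          ⟨U.sub_mem hc hu₁, _, hv₁, n, by simp only; abel⟩
        simp only [sub_sub_cancel] at e₂
        exact ⟨w, hw, by rw [e₂, mul_smul]⟩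
    have hmc : m - c ∈ V := hV.le_of_ge hV' le_sup_left
      (le_sup_right (a := V) (Submodule.mem_span_singleton_self _))
    exact Submodule.mem_sup.2 ⟨c, hc, m - c, hmc, by abel⟩

/-- In a maximal valuation domain the exceptional ideals `a P` need not be excluded. -/
theorem IsMaximalVD.isCompleteQuot {S : Type*} [CommRing S] [IsDomain S] [IsLocalRing S]
    (htot : ∀ x y : S, x ∣ y ∨ y ∣ x) (hS : IsMaximalVD S (IsLocalRing.maximalIdeal S))
    (A : Ideal S) : IsCompleteQuot S A := by
  by_cases hA : A = ⊤
  · subst hA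
    intro ι a B hAB _ _
    exact ⟨0, fun i => by rw [top_le_iff.1 (hAB i)]; trivial⟩
  by_cases hex : ∀ a : S, a ≠ 0 → A ≠ Ideal.span {a} * IsLocalRing.maximalIdeal S
  · exact hS A hA hex
  push Not at hex
  obtain ⟨a₀, ha₀, rfl⟩ := hex
  intro ι a B hAB hab hinf
  by_cases hmin : ∃ i, B i ≤ Ideal.span {a₀} * IsLocalRing.maximalIdeal S
  · obtain ⟨i, hi⟩ := hmin
    exact ⟨a i, fun j => hab i j (hi.trans (hAB j))⟩
  push Not at hmin
  have hmem : a₀ ∈ Ideal.span {a₀} * IsLocalRing.maximalIdeal S := by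
    rw [← hinf, Submodule.mem_iInf]
    intro i
    obtain ⟨b, hb, hbn⟩ := SetLike.not_le_iff_exists.1 (hmin i)
    rcases htot a₀ b with ⟨k, rfl⟩ | h
    · have hk : IsUnit k := by
        by_contra hk
        exact hbn (Ideal.mul_mem_mul (Ideal.mem_span_singleton_self _) hk)
      exact (Ideal.mul_unit_mem_iff_mem _ hk).1 hb
    · exact Ideal.mem_of_dvd _ h hb
  obtain ⟨z, hz, e⟩ := Ideal.mem_span_singleton_mul.1 hmem
  have : z = 1 := mul_left_cancel₀ ha₀ (by rw [e, mul_one])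
  exact ((IsLocalRing.mem_maximalIdeal _).1 hz (this ▸ isUnit_one)).elim

/-- An ideal `E` of `R` that is a module over a maximal `R_J` is compact for the cosets of its
submodules `t E`. -/
theorem exists_mem_of_isMaximalVD {R : Type u} [CommRing R] [IsDomain R] [ValuationRing R]
    (J : Ideal R) [J.IsPrime]
    (hmax : IsMaximalVD (Localization.AtPrime J)
        (IsLocalRing.maximalIdeal (Localization.AtPrime J)))
    (E : Ideal R) (hE : ∀ s ∉ J, ∀ e ∈ E, ∃ e' ∈ E, e = s * e')
    {ι : Type u} [Nonempty ι] (t e : ι → R) (he : ∀ i, e i ∈ E)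
    (hcoh : ∀ i j, t j ∣ t i → ∃ w ∈ E, e i - e j = t j * w) :
    ∃ c ∈ E, ∀ i, ∃ w ∈ E, c - e i = t i * w := by
  have hinj : Function.Injective (algebraMap R (Localization.AtPrime J)) :=
    IsLocalization.injective _ J.primeCompl_le_nonZeroDivisors
  let B : R → Ideal (Localization.AtPrime J) := fun t =>
    (Ideal.span {t} * E).map (algebraMap R _)
  have hB : ∀ t z, z ∈ B t ↔ ∃ w ∈ E, algebraMap R _ (t * w) = z := by
    intro t z
    constructor
    · intro hz
      obtain ⟨⟨⟨b, hb⟩, s⟩, h⟩ := (IsLocalization.mem_map_algebraMap_iff J.primeCompl _).1 hz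
      obtain ⟨w, hw, rfl⟩ := Ideal.mem_span_singleton_mul.1 hb
      obtain ⟨w', hw', rfl⟩ := hE s s.2 w hw
      refine ⟨w', hw', (IsLocalization.map_units (Localization.AtPrime J) s).mul_right_cancel ?_⟩
      rw [h, ← map_mul]
      congr 1
      change _ = t * (s * w')
      ring
    · rintro ⟨w, hw, rfl⟩
      exact Ideal.mem_map_of_mem _ (Ideal.mul_mem_mul (Ideal.mem_span_singleton_self _) hw)
  have hsub : ∀ i j, t j ∣ t i →
      algebraMap R (Localization.AtPrime J) (e i) - algebraMap R _ (e j) ∈ B (t j) := by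
    intro i j h
    obtain ⟨w, hw, e'⟩ := hcoh i j h
    rw [← map_sub, hB]
    exact ⟨w, hw, by rw [e']⟩
  obtain ⟨c, hc⟩ := hmax.isCompleteQuot (dvd_total_localization J) (⨅ i, B (t i)) ι
    (fun i => algebraMap R _ (e i)) (fun i => B (t i)) (fun i => iInf_le _ i)
    (fun i j h => by
      rcases ValuationRing.dvd_total (t j) (t i) with hd | hd
      · exact hsub i j hd
      · have := h (hsub j i hd)
        rw [← neg_sub]
        exact neg_mem this) rfl
  choose w hw hwe using fun i => (hB _ _).1 (hc i)
  obtain ⟨o⟩ := ‹Nonempty ι›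
  have hcR : c = algebraMap R _ (e o + t o * w o) := by
    rw [map_add, hwe]
    ring
  refine ⟨_, E.add_mem (he o) (E.mul_mem_left (t o) (hw o)), fun i => ⟨w i, hw i, hinj ?_⟩⟩
  rw [hwe, map_sub, ← hcR]

theorem isSeparableMod_of_isMaximalVD {R : Type u} [CommRing R] [IsDomain R] [ValuationRing R]
    (P : Ideal R) (hP : P.IsMaximal) (J : Ideal R) (hJ : J = ⨅ n : ℕ, P ^ n) [J.IsPrime]
    (hmax : IsMaximalVD (Localization.AtPrime J)
        (IsLocalRing.maximalIdeal (Localization.AtPrime J))) (X : Type u) :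
    IsSeparableMod R (X → R) := by
  intro U hpure huni
  have hcmp : ∀ v ∈ U, ∀ w ∈ U, (∃ k : R, w = k • v) ∨ ∃ k : R, v = k • w := by
    intro v hv w hw
    rcases huni (Submodule.span R {⟨v, hv⟩}) (Submodule.span R {⟨w, hw⟩}) with h | h
    · right
      obtain ⟨k, hk⟩ := Submodule.mem_span_singleton.1 (h (Submodule.mem_span_singleton_self _))
      exact ⟨k, (congrArg Subtype.val hk).symm⟩
    · left
      obtain ⟨k, hk⟩ := Submodule.mem_span_singleton.1 (h (Submodule.mem_span_singleton_self _))
      exact ⟨k, (congrArg Subtype.val hk).symm⟩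
  by_cases hunit : ∃ u ∈ U, ∃ i, IsUnit (u i)
  · obtain ⟨u, hu, i, q, hq⟩ := hunit
    refine ⟨LinearMap.ker (LinearMap.proj i : (X → R) →ₗ[R] R), ?_, ?_⟩
    · rw [Submodule.disjoint_def]
      intro w hw hwi
      change w i = 0 at hwi
      rcases hcmp u hu w hw with ⟨k, rfl⟩ | ⟨k, rfl⟩
      · rw [Pi.smul_apply, smul_eq_mul, ← hq, Units.mul_left_eq_zero] at hwi
        rw [hwi, zero_smul]
      · rw [Pi.smul_apply, hwi, smul_zero] at hq
        exact (q.ne_zero hq).elim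
    · rw [codisjoint_iff, eq_top_iff]
      rintro m -
      refine Submodule.mem_sup.2 ⟨(m i * ↑q⁻¹) • u, U.smul_mem _ hu,
        m - (m i * ↑q⁻¹) • u, ?_, by abel⟩
      change m i - (m i * ↑q⁻¹) * u i = 0
      rw [← hq, mul_assoc, q.inv_mul, mul_one, sub_self]
  push Not at hunit
  have hUP : ∀ u ∈ U, ∀ i, u i ∈ P := by
    intro u hu i
    rw [IsLocalRing.eq_maximalIdeal hP]
    exact hunit u hu i
  have hdiv : ∀ s ∉ J, ∀ u ∈ U, ∃ u' ∈ U, u = s • u' := by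
    intro s hs
    rw [hJ, Submodule.mem_iInf] at hs
    push Not at hs
    obtain ⟨n, hn⟩ := hs
    by_cases hpr : P.IsPrincipal
    · obtain ⟨p, hp⟩ := hpr
      have hp' : P = Ideal.span {p} := hp
      have hpow : ∀ n : ℕ, ∀ u ∈ U, ∃ u' ∈ U, u = p ^ n • u' := by
        intro n
        induction n with
        | zero => exact fun u hu => ⟨u, hu, by simp⟩
        | succ n ih =>
          intro u hu
          obtain ⟨u₁, hu₁, rfl⟩ := ih u hu
          have h1 := hUP u₁ hu₁
          simp only [hp', Ideal.mem_span_singleton] at h1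
          choose k hk using h1
          obtain ⟨u₂, hu₂, e⟩ := hpure p u₁ hu₁ ⟨k, (funext hk).symm⟩
          exact ⟨u₂, hu₂, by rw [← e, smul_smul, pow_succ]⟩
      intro u hu
      obtain ⟨u₁, hu₁, rfl⟩ := hpow n u hu
      rw [hp', Ideal.span_singleton_pow, Ideal.mem_span_singleton] at hn
      obtain ⟨k, hk⟩ := (ValuationRing.dvd_total _ _).resolve_left hn
      exact ⟨k • u₁, U.smul_mem _ hu₁, by rw [hk, mul_smul]⟩
    · have hsu : IsUnit s := by
        by_contra h
        apply hn
        apply le_pow_of_not_isPrincipal P hP hpr n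
        rw [IsLocalRing.eq_maximalIdeal hP]
        exact h
      obtain ⟨q, rfl⟩ := hsu
      exact fun u hu => ⟨(↑q⁻¹ : R) • u, U.smul_mem _ hu, by simp [smul_smul]⟩
  by_cases hbot : U = ⊥
  · exact ⟨⊤, by rw [hbot]; exact isCompl_bot_top⟩
  obtain ⟨u₀, hu₀, hne⟩ := (Submodule.ne_bot_iff U).1 hbot
  obtain ⟨i, hi⟩ := Function.ne_iff.1 hne
  have hzero : ∀ w ∈ U, w i = 0 → w = 0 := by
    intro w hw hwi
    rcases hcmp u₀ hu₀ w hw with ⟨k, rfl⟩ | ⟨k, rfl⟩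
    · rw [(mul_eq_zero.1 hwi).resolve_right hi, zero_smul]
    · exact (hi (by rw [Pi.smul_apply, hwi, smul_zero]; rfl)).elim
  apply isSummand_of_coset_compact U hpure
  intro Λ hΛne hΛU hΛ
  let E : Ideal R := U.map (LinearMap.proj i : (X → R) →ₗ[R] R)
  have : Nonempty Λ := hΛne.to_subtype
  obtain ⟨c, ⟨c, hc, rfl⟩, h⟩ := exists_mem_of_isMaximalVD J hmax E
    (by
      rintro s hs _ ⟨u, hu, rfl⟩
      obtain ⟨u', hu', rfl⟩ := hdiv s hs u hu
      exact ⟨_, ⟨u', hu', rfl⟩, rfl⟩)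
    (fun p : Λ => p.1.1) (fun p : Λ => p.1.2 i) (fun p => ⟨_, hΛU p.1 p.2, rfl⟩)
    (by
      intro p q hd
      obtain ⟨w, hw, e⟩ := hΛ p.1 p.2 q.1 q.2 hd
      exact ⟨w i, ⟨w, hw, rfl⟩, congrFun e i⟩)
  refine ⟨c, hc, fun p hp => ?_⟩
  obtain ⟨_, ⟨w, hw, rfl⟩, e⟩ := h ⟨p, hp⟩
  refine ⟨w, hw, sub_eq_zero.1 (hzero _
    (U.sub_mem (U.sub_mem hc (hΛU p hp)) (U.smul_mem _ hw)) ?_)⟩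
  exact sub_eq_zero.2 e

/-- if `R_L` is countably generated over `R` for each prime `L` and
`J = ⋂ₙ Pⁿ`, then `R^R` is separable iff `R_J` is a maximal valuation domain. -/
theorem stmt_10 {R : Type u} [CommRing R] [IsDomain R] [ValuationRing R]
    (P : Ideal R) (hP : P.IsMaximal)
    (hcg : ∀ (L : Ideal R) [L.IsPrime],
      ∃ S : Set (Localization.AtPrime L), S.Countable ∧ Submodule.span R S = ⊤)
    (J : Ideal R) (hJ : J = ⨅ n : ℕ, P ^ n) [J.IsPrime] :
    IsSeparableMod R (R → R) ↔
      IsMaximalVD (Localization.AtPrime J)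
        (IsLocalRing.maximalIdeal (Localization.AtPrime J)) := by
  constructor
  · intro hsep
    refine isMaximalVD_of_isSeparableMod hsep hcg J fun u hu => ?_
    subst hJ
    exact exists_mem_iInf_pow_eq_mul P hP u hu
  · exact fun hmax => isSeparableMod_of_isMaximalVD P hP J hJ hmax R
end

section
/- Let R be a valuation domain with maximal ideal P, J = ⋂_{n∈ℕ} P^n, and suppose R^R is a separable R-module. Then for every prime ideal L with L ⊊ J, the ring R/L is not slender. -/
open Pointwise

section ValuationHelpers
universe u
variable {R : Type u} [CommRing R]

/-- Every nonzero element of `⋂ₙ Pⁿ` starts an infinite chain of proper divisors. -/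
theorem exists_divisor_chain [IsDomain R] [ValuationRing R] (P : Ideal R) (hP : P.IsMaximal) (a : R)
    (ha : a ∈ ⨅ n : ℕ, P ^ n) (ha0 : a ≠ 0) :
    ∃ s : ℕ → R, s 0 = a ∧ ∀ n, ∃ t ∈ P, s n = t * s (n + 1) := by
  obtain ⟨C, haC, hC⟩ : ∃ C : Set R, a ∈ C ∧ ∀ x : C, ∃ y : C, ∃ t ∈ P, (x : R) = t * y := by
    by_cases hpr : ∃ p, P = Ideal.span {p}
    · obtain ⟨p, rfl⟩ := hpr
      simp only [Ideal.span_singleton_pow, Ideal.mem_iInf, Ideal.mem_span_singleton] at ha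
      have hp0 : p ≠ 0 := by
        rintro rfl
        exact ha0 (by simpa using ha 1)
      refine ⟨{x | ∀ n : ℕ, p ^ n ∣ x}, ha, ?_⟩
      rintro ⟨x, hx⟩
      obtain ⟨y, rfl⟩ : p ∣ x := by simpa using hx 1
      refine ⟨⟨y, fun n => ?_⟩, p, Ideal.mem_span_singleton_self p, rfl⟩
      have h := hx (n + 1)
      rw [pow_succ'] at h
      exact (mul_dvd_mul_iff_left hp0).1 h
    · refine ⟨P, by simpa using (Ideal.mem_iInf.1 ha) 1, ?_⟩
      rintro ⟨x, hx⟩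
      obtain ⟨u, huP, hu⟩ : ∃ u ∈ P, u ∉ Ideal.span {x} := by
        by_contra! h
        exact hpr ⟨x, le_antisymm h ((Ideal.span_singleton_le_iff_mem _).2 hx)⟩
      rw [Ideal.mem_span_singleton] at hu
      obtain ⟨t, rfl⟩ := (ValuationRing.dvd_total u x).resolve_right hu
      refine ⟨⟨u, huP⟩, t, ?_, mul_comm _ _⟩
      by_contra ht
      have htu : IsUnit t := by
        by_contra hn
        exact ht (by rw [IsLocalRing.eq_maximalIdeal hP]; exact hn)
      exact hu ((htu.mul_right_dvd).2 dvd_rfl)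
  choose next hnext using hC
  refine ⟨fun n => (next^[n] ⟨a, haC⟩ : C), rfl, fun n => ?_⟩
  simp only [Function.iterate_succ_apply']
  exact hnext _

/-- The pure closure of `R x` in `ι → R`, where `x i₀ ≠ 0`. -/
def pureLine {ι : Type*} (x : ι → R) (i₀ : ι) : Submodule R (ι → R) where
  carrier := {y | ∀ i, x i₀ * y i = y i₀ * x i}
  zero_mem' := by simp
  add_mem' := by
    intro y z hy hz i
    simp only [Pi.add_apply, mul_add, add_mul, hy i, hz i]
  smul_mem' := by
    intro c y hy i
    simp only [Pi.smul_apply, smul_eq_mul]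
    linear_combination c * hy i

theorem isPureSub_pureLine [IsDomain R] {ι : Type*} (x : ι → R) (i₀ : ι) :
    IsPureSub R (pureLine x i₀) := by
  rintro r _ hy ⟨m, rfl⟩
  by_cases hr : r = 0
  · exact ⟨0, Submodule.zero_mem _, by simp [hr]⟩
  · refine ⟨m, fun i => mul_left_cancel₀ hr ?_, rfl⟩
    have := hy i
    simp only [Pi.smul_apply, smul_eq_mul] at this
    linear_combination this

theorem isUniserialSub_pureLine [IsDomain R] [ValuationRing R]
    {ι : Type*} (x : ι → R) (i₀ : ι) (hx : x i₀ ≠ 0) :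
    IsUniserialSub R (pureLine x i₀) := by
  have key : ∀ y z : pureLine x i₀, y.1 i₀ ∣ z.1 i₀ → ∃ c : R, z = c • y := by
    rintro ⟨y, hy⟩ ⟨z, hz⟩ ⟨c, hc⟩
    refine ⟨c, Subtype.ext (funext fun i => mul_left_cancel₀ hx ?_)⟩
    have h1 := hy i
    have h2 := hz i
    simp only at hc
    simp only [SetLike.mk_smul_mk, Pi.smul_apply, smul_eq_mul]
    rw [h2, hc]
    linear_combination -c * h1
  intro A B
  by_contra! h
  obtain ⟨⟨y, hyA, hyB⟩, ⟨z, hzB, hzA⟩⟩ := And.intro (Set.not_subset.1 h.1) (Set.not_subset.1 h.2)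
  rcases ValuationRing.dvd_total (y.1 i₀) (z.1 i₀) with h | h
  · obtain ⟨c, rfl⟩ := key _ _ h
    exact hzA (A.smul_mem c hyA)
  · obtain ⟨c, rfl⟩ := key _ _ h
    exact hyB (B.smul_mem c hzB)

/-- A divisor chain `s` in `R` yields a functional on `R^ℕ` that takes the value `s 0` at `s` and
is small on the coordinates of `s`. -/
theorem exists_functional [IsDomain R] [ValuationRing R] [Infinite R]
    (hsep : IsSeparableMod R (R → R)) (P : Ideal R) (s : ℕ → R) (hs0 : s 0 ≠ 0)
    (hs : ∀ n, ∃ t ∈ P, s n = t * s (n + 1)) :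
    ∃ G : (ℕ → R) →ₗ[R] R, G s = s 0 ∧
      ∀ n, ∃ c ∈ P, G (Pi.single n (s n)) = s 0 * c := by
  let φ := Infinite.natEmbedding R
  let E : (ℕ → R) →ₗ[R] (R → R) := Function.ExtendByZero.linearMap R φ
  have hE : ∀ a n, E a (φ n) = a n := fun a n => φ.injective.extend_apply _ _ _
  let U := pureLine (E s) (φ 0)
  have hx0 : E s (φ 0) ≠ 0 := by rwa [hE]
  obtain ⟨V, hV⟩ := hsep U (isPureSub_pureLine _ _) (isUniserialSub_pureLine _ _ hx0)
  let f := U.projectionOnto V hV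
  refine ⟨LinearMap.proj (φ 0) ∘ₗ U.subtype ∘ₗ f ∘ₗ E, ?_, fun n => ?_⟩
  · have hmem : E s ∈ U := fun i => rfl
    have : f (E s) = ⟨E s, hmem⟩ := Submodule.projectionOnto_apply_left hV ⟨E s, hmem⟩
    simp [this, hE]
  · obtain ⟨t, ht, hst⟩ := hs n
    have hw := (f (E (Pi.single n 1))).2 (φ (n + 1))
    rw [hE, hE] at hw
    refine ⟨t * (f (E (Pi.single n 1))).1 (φ (n + 1)), P.mul_mem_right _ ht, ?_⟩
    have h1 : (Pi.single n (s n) : ℕ → R) = s n • Pi.single n 1 := by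
      rw [← Pi.single_smul]; simp
    rw [h1, map_smul]
    simp only [LinearMap.comp_apply, LinearMap.proj_apply, Submodule.subtype_apply, smul_eq_mul]
    rw [hst]
    linear_combination -t * hw

/-- Functionals on `R^ℕ` preserve every non-maximal prime ideal. -/
theorem functional_mem_of_forall_mem [IsDomain R] [ValuationRing R] (P L : Ideal R)
    (hP : P ≠ ⊤) (hL : L.IsPrime) (hLP : L < P)
    (H : (ℕ → R) →ₗ[R] R) (y : ℕ → R) (hy : ∀ n, y n ∈ L) : H y ∈ L := by
  by_contra hh
  obtain ⟨p, hpP, hpL⟩ := SetLike.exists_of_lt hLP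
  have hs : p * H y ∉ L := fun h => (hL.mem_or_mem h).elim hpL hh
  have hdvd : ∀ n, p * H y ∣ y n := fun n =>
    (ValuationRing.dvd_total _ _).resolve_right fun h => hs (L.mem_of_dvd h (hy n))
  choose z hz using hdvd
  have hyz : y = (p * H y) • z := funext hz
  have h1 : H y = p * H y * H z := by
    conv_lhs => rw [hyz, map_smul, smul_eq_mul]
  have h0 : H y ≠ 0 := fun h => hh (h ▸ L.zero_mem)
  have h2 : 1 = p * H z := mul_left_cancel₀ h0 (by linear_combination h1)
  exact hP ((Ideal.eq_top_iff_one P).2 (h2 ▸ P.mul_mem_right _ hpP))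

/-- A functional on `R^ℕ` that preserves `L` descends to `R ⧸ L`. -/
theorem exists_quotient_functional (L : Ideal R) (H : (ℕ → R) →ₗ[R] R)
    (hH : ∀ y : ℕ → R, (∀ n, y n ∈ L) → H y ∈ L) :
    ∃ F : (ℕ → R ⧸ L) →ₗ[R ⧸ L] R ⧸ L,
      ∀ y : ℕ → R, F (fun n => Ideal.Quotient.mk L (y n)) = Ideal.Quotient.mk L (H y) := by
  have hcongr : ∀ y z : ℕ → R,
      (∀ n, Ideal.Quotient.mk L (y n) = Ideal.Quotient.mk L (z n)) →
      Ideal.Quotient.mk L (H y) = Ideal.Quotient.mk L (H z) := fun y z h => by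
    rw [Ideal.Quotient.eq, ← map_sub]
    exact hH _ fun n => Ideal.Quotient.eq.1 (h n)
  choose σ hσ using Ideal.Quotient.mk_surjective (I := L)
  refine ⟨{ toFun := fun a => Ideal.Quotient.mk L (H fun n => σ (a n))
            map_add' := fun a b => ?_
            map_smul' := fun c a => ?_ }, fun y => hcongr _ _ fun n => hσ _⟩
  · rw [← map_add, ← map_add]
    exact hcongr _ _ fun n => by simp [hσ]
  · have h : Ideal.Quotient.mk L (H fun n => σ ((c • a) n)) =
        Ideal.Quotient.mk L (H (σ c • fun n => σ (a n))) :=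
      hcongr _ _ fun n => by simp [hσ]
    rw [h, map_smul, smul_eq_mul, map_mul, hσ]
    rfl

/-- The map `R^ℕ → R^ℕ` sending the `n`-th unit vector to the tail of `s` from `n` on. -/
def tailMap (s : ℕ → R) : (ℕ → R) →ₗ[R] (ℕ → R) where
  toFun a k := (∑ n ∈ Finset.range (k + 1), a n) * s k
  map_add' a b := by
    ext k
    simp [Finset.sum_add_distrib, add_mul]
  map_smul' c a := by
    ext k
    simp [← Finset.mul_sum, mul_assoc]

theorem tailMap_single (s : ℕ → R) (n : ℕ) :
    tailMap s (Pi.single n 1) = s - ∑ k ∈ Finset.range n, Pi.single k (s k) := by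
  ext k
  simp only [tailMap, LinearMap.coe_mk, AddHom.coe_mk, Pi.sub_apply, Finset.sum_apply,
    Pi.single_apply, Finset.sum_ite_eq', Finset.sum_ite_eq, Finset.mem_range]
  split_ifs <;> first | omega | simp

end ValuationHelpers

/-- if `R^R` is separable, then `R/L` is not slender for any prime
`L ⊊ J = ⋂ₙ Pⁿ`. -/
theorem stmt_12 {R : Type u} [CommRing R] [IsDomain R] [ValuationRing R]
    (P : Ideal R) (hP : P.IsMaximal) (J : Ideal R) (hJ : J = ⨅ n : ℕ, P ^ n)
    (hsep : IsSeparableMod R (R → R))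
    (L : Ideal R) (hL : L.IsPrime) (hLJ : L < J) :
    ¬ IsSlender (R ⧸ L) (R ⧸ L) := by
  have hLP : L < P := hLJ.trans_le (by rw [hJ]; exact (iInf_le _ 1).trans (pow_one P).le)
  obtain ⟨a, haJ, haL⟩ := SetLike.exists_of_lt hLJ
  have ha0 : a ≠ 0 := fun h => haL (h ▸ L.zero_mem)
  have : Infinite R := by
    by_contra hfin
    have : Finite R := not_infinite_iff_finite.1 hfin
    let := (Finite.isField_of_domain R).toField
    exact not_lt_bot ((Ideal.eq_bot_of_prime P) ▸ hLP)
  obtain ⟨s, rfl, hs⟩ := exists_divisor_chain P hP a (hJ ▸ haJ) ha0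
  obtain ⟨G, hGs, hG⟩ := exists_functional hsep P s ha0 hs
  choose c hcP hc using hG
  obtain ⟨F, hF⟩ := exists_quotient_functional L (G ∘ₗ tailMap s)
    (functional_mem_of_forall_mem P L hP.ne_top hL hLP _)
  intro hsl
  obtain ⟨n, hn⟩ := hsl F
  have h1 : (Pi.single n 1 : ℕ → R ⧸ L) =
      fun k => Ideal.Quotient.mk L ((Pi.single n 1 : ℕ → R) k) := by
    ext k
    simp only [Pi.single_apply]
    split_ifs <;> simp
  have h2 := hn n le_rfl
  rw [h1, hF, Ideal.Quotient.eq_zero_iff_mem, LinearMap.comp_apply, tailMap_single, map_sub,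
    map_sum, hGs, Finset.sum_congr rfl fun k _ => hc k, ← Finset.mul_sum] at h2
  have h3 : s 0 * (1 - ∑ k ∈ Finset.range n, c k) ∈ L := by rwa [mul_sub, mul_one]
  have h4 := hLP.le ((hL.mem_or_mem h3).resolve_left haL)
  have h5 := P.add_mem h4 (P.sum_mem fun k (_ : k ∈ Finset.range n) => hcP k)
  rw [sub_add_cancel] at h5
  exact hP.ne_top ((Ideal.eq_top_iff_one P).2 h5)
end

section
/- Let R be a valuation domain with maximal ideal P, J = ⋂_{n∈ℕ} P^n, and suppose R^R is a separable R-module. Then for every ideal A of R which is not isomorphic (as R-module) to a prime ideal and which satisfies A^♯ ⊆ J, the ring R/A is complete in the R/A-topology. -/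
open Pointwise

section Preliminaries
variable {R : Type*} [CommRing R]

/-- An ideal of the form `bL` with `b ≠ 0` is isomorphic to `L`. -/
theorem nonempty_linearEquiv_of_mem_iff [IsDomain R] {I L : Ideal R} {b : R} (hb : b ≠ 0)
    (h : ∀ x, x ∈ I ↔ ∃ l ∈ L, b * l = x) : Nonempty (I ≃ₗ[R] L) := by
  let f : L →ₗ[R] I :=
    { toFun := fun l => ⟨b * l, (h _).2 ⟨l, l.2, rfl⟩⟩
      map_add' := fun l m => Subtype.ext (by simp [mul_add])
      map_smul' := fun r l => Subtype.ext (by simp [mul_left_comm]) }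
  refine ⟨(LinearEquiv.ofBijective f ⟨fun l m hlm => Subtype.ext ?_, fun x => ?_⟩).symm⟩
  · exact mul_left_cancel₀ hb (congrArg Subtype.val hlm)
  · obtain ⟨l, hl, hx⟩ := (h x).1 x.2
    exact ⟨⟨l, hl⟩, Subtype.ext hx⟩

open Classical in
/-- The vector in `R^R` listing the elements of an ideal, extended by zero. -/
noncomputable def idealVec (L : Ideal R) (r : R) : R :=
  if r ∈ L then r else 0

theorem idealVec_of_mem {L : Ideal R} {r : R} (h : r ∈ L) : idealVec L r = r :=
  if_pos h

theorem isUniserialSub_of_total {M : Type*} [AddCommGroup M] [Module R M] {U : Submodule R M}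
    (h : ∀ u ∈ U, ∀ v ∈ U, (∃ r : R, u = r • v) ∨ ∃ r : R, v = r • u) : IsUniserialSub R U := by
  intro S T
  by_contra! hST
  obtain ⟨u, hu, huT⟩ := SetLike.not_le_iff_exists.1 hST.1
  obtain ⟨v, hv, hvS⟩ := SetLike.not_le_iff_exists.1 hST.2
  rcases h u u.2 v v.2 with ⟨r, hr⟩ | ⟨r, hr⟩
  · exact huT ((Subtype.ext hr : u = r • v) ▸ T.smul_mem r hv)
  · exact hvS ((Subtype.ext hr : v = r • u) ▸ S.smul_mem r hu)

end Preliminaries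

section Sharp
variable {R : Type*} [CommRing R] [IsDomain R] [ValuationRing R]

/-- The sharp prime `A^♯ = {s : sA ≠ A}` of a nonzero ideal `A` of a valuation domain. -/
def sharpIdeal (A : Ideal R) (hA : A ≠ ⊥) : Ideal R where
  carrier := {s | ¬ ∀ a ∈ A, ∃ a' ∈ A, s * a' = a}
  zero_mem' := fun h => hA <| (Submodule.eq_bot_iff A).2 fun a ha => by
    obtain ⟨a', -, h'⟩ := h a ha
    simpa using h'.symm
  add_mem' := by
    intro s t hs ht hst
    obtain ⟨m, hm | hm⟩ := ValuationRing.cond s t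
    · refine hs fun a ha => ?_
      obtain ⟨a', ha', h⟩ := hst a ha
      exact ⟨(1 + m) * a', A.mul_mem_left _ ha', by rw [← h, ← hm]; ring⟩
    · refine ht fun a ha => ?_
      obtain ⟨a', ha', h⟩ := hst a ha
      exact ⟨(1 + m) * a', A.mul_mem_left _ ha', by rw [← h, ← hm]; ring⟩
  smul_mem' := by
    intro r s hs hrs
    refine hs fun a ha => ?_
    obtain ⟨a', ha', h⟩ := hrs a ha
    exact ⟨r * a', A.mul_mem_left _ ha', by rw [← h, smul_eq_mul]; ring⟩

variable {A : Ideal R} {hA : A ≠ ⊥}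

theorem notMem_sharpIdeal {s : R} :
    s ∉ sharpIdeal A hA ↔ ∀ a ∈ A, ∃ a' ∈ A, s * a' = a :=
  not_not

theorem mem_sharpIdeal {s : R} :
    s ∈ sharpIdeal A hA ↔ ¬ ∀ a ∈ A, ∃ a' ∈ A, s * a' = a :=
  Iff.rfl

theorem one_notMem_sharpIdeal : (1 : R) ∉ sharpIdeal A hA :=
  notMem_sharpIdeal.2 fun a ha => ⟨a, ha, one_mul a⟩

theorem mul_notMem_sharpIdeal {s t : R} (hs : s ∉ sharpIdeal A hA) (ht : t ∉ sharpIdeal A hA) :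
    s * t ∉ sharpIdeal A hA := by
  rw [notMem_sharpIdeal] at *
  intro a ha
  obtain ⟨a', ha', rfl⟩ := hs a ha
  obtain ⟨a'', ha'', rfl⟩ := ht a' ha'
  exact ⟨a'', ha'', mul_assoc _ _ _⟩

theorem sharpIdeal_isPrime : (sharpIdeal A hA).IsPrime :=
  Ideal.isPrime_iff.2 ⟨fun h => one_notMem_sharpIdeal ((Ideal.eq_top_iff_one _).1 h),
    fun {_ _} h => or_iff_not_and_not.2 fun ⟨hs, ht⟩ => mul_notMem_sharpIdeal hs ht h⟩

theorem le_sharpIdeal (hA' : A ≠ ⊤) : A ≤ sharpIdeal A hA := by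
  intro a ha
  by_cases h0 : a = 0
  · exact h0 ▸ zero_mem _
  · refine mem_sharpIdeal.2 fun h => hA' ?_
    obtain ⟨a', ha', h'⟩ := h a ha
    rw [Ideal.eq_top_iff_one, ← mul_left_cancel₀ h0 (h'.trans (mul_one a).symm)]
    exact ha'

/-- In a valuation domain an element outside an ideal divides every element of the ideal. -/
theorem Ideal.dvd_of_notMem {B : Ideal R} {b x : R} (hb : b ∉ B) (hx : x ∈ B) : b ∣ x := by
  rcases ValuationRing.dvd_total b x with h | h
  · exact h
  · exact absurd (B.mem_of_dvd h hx) hb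

/-- If `A^♯` is a nonzero principal ideal, then `A` is isomorphic to `A^♯`. -/
theorem nonempty_linearEquiv_sharpIdeal_of_principal {e : R} (he : e ∈ sharpIdeal A hA)
    (he0 : e ≠ 0) (hle : ∀ l ∈ sharpIdeal A hA, e ∣ l) :
    Nonempty (A ≃ₗ[R] sharpIdeal A hA) := by
  have hunit : ∀ s, s ∉ sharpIdeal A hA → IsUnit s := by
    intro s hs
    obtain ⟨e', rfl⟩ := Ideal.dvd_of_notMem hs he
    have he' : e' ∈ sharpIdeal A hA := by
      by_contra h
      exact mul_notMem_sharpIdeal hs h he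
    obtain ⟨t, ht⟩ := hle e' he'
    refine IsUnit.of_mul_eq_one t (mul_left_cancel₀ (right_ne_zero_of_mul he0) ?_)
    linear_combination -ht
  have hex := mem_sharpIdeal.1 he
  push Not at hex
  obtain ⟨a, ha, hae⟩ := hex
  have ha0 : a ≠ 0 := fun h => hae 0 A.zero_mem (by simp [h])
  have hdvd : ∀ x ∈ A, a ∣ x := by
    intro x hx
    rcases ValuationRing.dvd_total a x with h | ⟨m, hm⟩
    · exact h
    · by_cases hmL : m ∈ sharpIdeal A hA
      · obtain ⟨t, rfl⟩ := hle m hmL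
        exact absurd (by rw [hm]; ring) (hae (x * t) (A.mul_mem_right _ hx))
      · obtain ⟨v, rfl⟩ := hunit m hmL
        exact ⟨↑v⁻¹, by simp [hm]⟩
  obtain ⟨i⟩ := nonempty_linearEquiv_of_mem_iff (I := A) (L := ⊤) ha0 fun x =>
    ⟨fun hx => (hdvd x hx).imp fun m hm => ⟨trivial, hm.symm⟩,
      fun ⟨m, _, hm⟩ => hm ▸ A.mul_mem_right _ ha⟩
  obtain ⟨j⟩ := nonempty_linearEquiv_of_mem_iff (I := sharpIdeal A hA) (L := ⊤) he0 fun x =>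
    ⟨fun hx => (hle x hx).imp fun m hm => ⟨trivial, hm.symm⟩,
      fun ⟨m, _, hm⟩ => hm ▸ Ideal.mul_mem_right _ _ he⟩
  exact ⟨i.trans j.symm⟩

/-- If `A` is not isomorphic to `A^♯` and `A < B`, then `B` contains some `b ∉ A` together with
all its quotients by elements outside `A^♯`. -/
theorem exists_divisible_mem (hiso : ¬ Nonempty (A ≃ₗ[R] sharpIdeal A hA)) {B : Ideal R}
    (hAB : A < B) :
    ∃ b ∈ B, b ∉ A ∧ ∀ s ∉ sharpIdeal A hA, ∃ d ∈ B, s * d = b := by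
  by_contra! hcon
  have hcomp : ∀ b₀ ∈ B, b₀ ∉ A → ∀ b ∈ B, ∃ s ∉ sharpIdeal A hA, b₀ ∣ s * b := by
    intro b₀ hb₀ hb₀A b hb
    obtain ⟨s, hs, hsd⟩ := hcon b₀ hb₀ hb₀A
    refine ⟨s, hs, (ValuationRing.dvd_total b₀ (s * b)).resolve_right fun ⟨e, he⟩ => ?_⟩
    exact hsd (b * e) (B.mul_mem_right _ hb) (by rw [he, mul_assoc])
  obtain ⟨b₀, hb₀, hb₀A⟩ := SetLike.exists_of_lt hAB
  have hb₀0 : b₀ ≠ 0 := fun h => hb₀A (h ▸ A.zero_mem)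
  refine hiso (nonempty_linearEquiv_of_mem_iff hb₀0 fun a => ⟨fun ha => ?_, ?_⟩)
  · obtain ⟨l, rfl⟩ := Ideal.dvd_of_notMem hb₀A ha
    refine ⟨l, mem_sharpIdeal.2 fun hl => hb₀A ?_, rfl⟩
    obtain ⟨a', ha', h⟩ := hl _ ha
    by_cases hl0 : l = 0
    · exact absurd (hl0 ▸ zero_mem _) (notMem_sharpIdeal (hA := hA).2 hl)
    · rwa [← mul_left_cancel₀ hl0 (h.trans (mul_comm _ _))]
  · rintro ⟨l, hl, rfl⟩
    by_contra hbl
    obtain ⟨s, hs, e, he⟩ := hcomp _ (B.mul_mem_right l hb₀) hbl b₀ hb₀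
    have : s = l * e := mul_left_cancel₀ hb₀0 (by linear_combination he)
    exact hs (this ▸ Ideal.mul_mem_right _ _ hl)

/-- If `A` is the intersection of the `B i`, every `l ∈ A^♯` multiplies some `B i` into `A`. -/
theorem exists_mul_mem_of_mem_sharpIdeal {ι : Type*} [Nonempty ι] {B : ι → Ideal R}
    (hB : ⨅ i, B i = A) {l : R} (hl : l ∈ sharpIdeal A hA) : ∃ i, ∀ b ∈ B i, l * b ∈ A := by
  by_contra! hcon
  refine mem_sharpIdeal.1 hl fun a ha => ?_
  choose b hb hlb using hcon
  choose m hm using fun i => Ideal.dvd_of_notMem (hlb i) ha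
  have i₀ := Classical.arbitrary ι
  have hl0 : l ≠ 0 := fun h => hlb i₀ (by simp [h])
  refine ⟨b i₀ * m i₀, ?_, by rw [hm i₀, mul_assoc]⟩
  rw [← hB, Submodule.mem_iInf]
  intro i
  have : b i₀ * m i₀ = b i * m i :=
    mul_left_cancel₀ hl0 (by rw [← mul_assoc, ← hm, hm i, mul_assoc])
  exact this ▸ (B i).mul_mem_right _ (hb i)

variable (A hA) in
/-- The rank one submodule `R_L x` of `R^R`, where `L = A^♯` and `x` lists the elements of `L`. -/
def sharpSubmodule : Submodule R (R → R) where
  carrier := {u | ∃ s ∉ sharpIdeal A hA, ∃ c : R, s • u = c • idealVec (sharpIdeal A hA)}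
  zero_mem' := ⟨1, one_notMem_sharpIdeal, 0, by simp⟩
  add_mem' := by
    rintro u v ⟨s, hs, c, hc⟩ ⟨t, ht, d, hd⟩
    refine ⟨s * t, mul_notMem_sharpIdeal hs ht, t * c + s * d, ?_⟩
    rw [smul_add, add_smul, mul_smul t c, mul_smul s d, ← hc, ← hd, smul_smul, smul_smul,
      mul_comm t s]
  smul_mem' := by
    rintro r u ⟨s, hs, c, hc⟩
    exact ⟨s, hs, r * c, by rw [smul_comm, hc, mul_smul]⟩

theorem ne_zero_of_notMem_sharpIdeal {s : R} (hs : s ∉ sharpIdeal A hA) : s ≠ 0 :=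
  fun h => hs (h ▸ zero_mem _)

theorem idealVec_mem_sharpSubmodule : idealVec (sharpIdeal A hA) ∈ sharpSubmodule A hA :=
  ⟨1, one_notMem_sharpIdeal, 1, rfl⟩

theorem sharpSubmodule_isPureSub (hiso : ¬ Nonempty (A ≃ₗ[R] sharpIdeal A hA)) :
    IsPureSub R (sharpSubmodule A hA) := by
  rintro r u hu ⟨m, rfl⟩
  by_cases hr : r = 0
  · exact ⟨0, zero_mem _, by simp [hr]⟩
  refine ⟨m, ?_, rfl⟩
  obtain ⟨s, hs, c, hc⟩ := hu
  rw [smul_smul] at hc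
  have hsr : s * r ≠ 0 := mul_ne_zero (ne_zero_of_notMem_sharpIdeal hs) hr
  rcases ValuationRing.dvd_total (s * r) c with ⟨e, rfl⟩ | ⟨e, he⟩
  · rw [mul_smul (s * r)] at hc
    exact ⟨1, one_notMem_sharpIdeal, e, by rw [one_smul]; exact smul_right_injective _ hsr hc⟩
  · have hc0 : c ≠ 0 := left_ne_zero_of_mul (he ▸ hsr)
    have he0 : e ≠ 0 := right_ne_zero_of_mul (he ▸ hsr)
    rw [he, mul_smul] at hc
    have hem : e • m = idealVec (sharpIdeal A hA) := smul_right_injective _ hc0 hc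
    refine ⟨e, fun heL => ?_, 1, by rw [hem, one_smul]⟩
    refine hiso (nonempty_linearEquiv_sharpIdeal_of_principal heL he0 fun l hl => ⟨m l, ?_⟩)
    exact (idealVec_of_mem hl).symm.trans (congrFun hem l).symm

theorem sharpSubmodule_isUniserialSub : IsUniserialSub R (sharpSubmodule A hA) := by
  refine isUniserialSub_of_total ?_
  rintro u ⟨s, hs, c, hc⟩ v ⟨t, ht, d, hd⟩
  have hst : s * t ≠ 0 := ne_zero_of_notMem_sharpIdeal (mul_notMem_sharpIdeal hs ht)
  have hu : (s * t) • u = (t * c) • idealVec (sharpIdeal A hA) := by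
    rw [mul_comm, mul_smul, hc, mul_smul]
  have hv : (s * t) • v = (s * d) • idealVec (sharpIdeal A hA) := by
    rw [mul_smul, hd, mul_smul]
  rcases ValuationRing.dvd_total (s * d) (t * c) with ⟨m, hm⟩ | ⟨m, hm⟩
  · refine Or.inl ⟨m, smul_right_injective _ hst ?_⟩
    change (s * t) • u = (s * t) • m • v
    rw [hu, hm, smul_comm, hv, smul_smul, mul_comm]
  · refine Or.inr ⟨m, smul_right_injective _ hst ?_⟩
    change (s * t) • v = (s * t) • m • u
    rw [hv, hm, smul_comm, hu, smul_smul, mul_comm]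

/-- Completeness of `R/A` from a linear retraction of `R^R` onto `R_L x`. -/
theorem exists_limit_of_retraction (hbot : sharpIdeal A hA ≠ ⊥)
    (hiso : ¬ Nonempty (A ≃ₗ[R] sharpIdeal A hA)) (F : (R → R) →ₗ[R] (R → R))
    (hFU : ∀ m, F m ∈ sharpSubmodule A hA)
    (hFx : F (idealVec (sharpIdeal A hA)) = idealVec (sharpIdeal A hA))
    {ι : Type*} [Nonempty ι] {a : ι → R} {B : ι → Ideal R} (hAB : ∀ i, A < B i)
    (hcoh : ∀ i j, B i ≤ B j → a i - a j ∈ B j) (hB : ⨅ i, B i = A) :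
    ∃ c : R, ∀ i, c - a i ∈ B i := by
  classical
  set L := sharpIdeal A hA
  set x := idealVec L
  have hφ : ∀ l : R, ∃ i, l ∈ L → ∀ b ∈ B i, l * b ∈ A := fun l =>
    if hl : l ∈ L then (exists_mul_mem_of_mem_sharpIdeal hB hl).imp fun _ h _ => h
    else ⟨Classical.arbitrary ι, fun h => absurd h hl⟩
  choose φ hφ using hφ
  let y : R → R := fun r => a (φ r) * x r
  have hcoord : ∀ k r, y r - a k * x r ∈ B k := by
    intro k r
    by_cases hr : r ∈ L
    · have hxr : x r = r := idealVec_of_mem hr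
      simp only [y, hxr, ← sub_mul]
      rcases le_total (B (φ r)) (B k) with h | h
      · exact Ideal.mul_mem_right _ _ (hcoh _ _ h)
      · refine (hAB k).le ?_
        rw [mul_comm, ← neg_sub, mul_neg]
        exact A.neg_mem (hφ r hr _ (hcoh _ _ h))
    · have hxr : x r = 0 := if_neg hr
      simp [y, hxr]
  have hfactor : ∀ k, ∀ b ∉ B k, ∃ v ∈ sharpSubmodule A hA, F y = a k • x + b • v := by
    intro k b hb
    choose w hw using fun r => Ideal.dvd_of_notMem hb (hcoord k r)
    have hyw : y = a k • x + b • w := by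
      funext r
      simpa [sub_eq_iff_eq_add'] using hw r
    exact ⟨F w, hFU w, by rw [hyw, map_add, map_smul, map_smul, hFx]⟩
  have hlim : ∀ j, ∃ c, c - a j ∈ B j ∧ F y = c • x := by
    intro j
    obtain ⟨b, hbj, hbA, hdiv⟩ := exists_divisible_mem hiso (hAB j)
    obtain ⟨k, hk⟩ : ∃ k, b ∉ B k := by
      by_contra! h
      exact hbA (hB ▸ (Submodule.mem_iInf _).2 h)
    have hkj : B k ≤ B j := (le_total _ _).resolve_right fun h => hk (h hbj)
    obtain ⟨v, ⟨s, hs, e, he⟩, hv⟩ := hfactor k b hk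
    obtain ⟨d, hd, rfl⟩ := hdiv s hs
    refine ⟨a k + d * e, ?_, ?_⟩
    · rw [add_sub_right_comm]
      exact add_mem (hcoh _ _ hkj) (Ideal.mul_mem_right _ _ hd)
    · rw [hv, add_smul, mul_comm s d, mul_smul, he, mul_smul]
  choose c hc hcx using hlim
  obtain ⟨l, hl, hl0⟩ := Submodule.exists_mem_ne_zero_of_ne_bot hbot
  refine ⟨c (Classical.arbitrary ι), fun i => ?_⟩
  have h := congrFun ((hcx (Classical.arbitrary ι)).symm.trans (hcx i)) l
  have hxl : x l = l := idealVec_of_mem hl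
  simp only [Pi.smul_apply, hxl, smul_eq_mul] at h
  rw [mul_right_cancel₀ hl0 h]
  exact hc i

end Sharp

/-- if `R^R` is separable, then `R/A` is complete in the `R/A`-topology for
every ideal `A` which is not isomorphic to a prime ideal and has `A^♯ ⊆ J = ⋂ₙ Pⁿ`. -/
theorem stmt_13 {R : Type u} [CommRing R] [IsDomain R] [ValuationRing R]
    (P : Ideal R) (hP : P.IsMaximal) (J : Ideal R) (hJ : J = ⨅ n : ℕ, P ^ n)
    (hsep : IsSeparableMod R (R → R))
    (A : Ideal R)
    (hiso : ¬ ∃ L : Ideal R, L.IsPrime ∧ Nonempty (↥A ≃ₗ[R] ↥L))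
    (hsharp : ∀ s : R, s • A ≠ A → s ∈ J) :
    IsCompleteQuot R A := by
  have hA : A ≠ ⊥ := by
    rintro rfl
    exact hiso ⟨⊥, Ideal.isPrime_bot, ⟨LinearEquiv.refl R _⟩⟩
  intro ι a B hAB hcoh hB
  by_cases hattained : ∃ j, B j = A
  · obtain ⟨j, hj⟩ := hattained
    exact ⟨a j, fun i => hcoh j i (hj ▸ hAB i)⟩
  push Not at hattained
  rcases isEmpty_or_nonempty ι with hι | hι
  · exact ⟨0, fun i => hι.elim i⟩
  have hAtop : A ≠ ⊤ := fun h =>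
    hattained (Classical.arbitrary ι) (h ▸ top_le_iff.1 (h ▸ hAB _))
  have hiso' : ¬ Nonempty (A ≃ₗ[R] sharpIdeal A hA) := fun h =>
    hiso ⟨_, sharpIdeal_isPrime, h⟩
  have hbot : sharpIdeal A hA ≠ ⊥ := fun h => hA (le_bot_iff.1 (h ▸ le_sharpIdeal hAtop))
  obtain ⟨V, hV⟩ := hsep _ (sharpSubmodule_isPureSub hiso') sharpSubmodule_isUniserialSub
  refine exists_limit_of_retraction hbot hiso'
    ((sharpSubmodule A hA).subtype ∘ₗ Submodule.projectionOnto _ V hV)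
    (fun m => Subtype.property _) ?_ (fun i => (hAB i).lt_of_ne (hattained i).symm) hcoh hB
  exact congrArg Subtype.val
    (Submodule.projectionOnto_apply_left hV ⟨_, idealVec_mem_sharpSubmodule⟩)
end
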